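/- arXiv:0709.3810 — 4 statements merged into one kernel-verified Lean document; each statement's English description precedes it below -/
import Mathlib

section
/- Let A ⊂ R^d be the affine hyperplane defined by x_1 + … + x_d = 1, let Δ ⊂ A be the standard open (d−1)-dimensional simplex defined by x_i > 0 for all i, and let c = (1/d, …, 1/d) be its center. Let H ⊂ A be an affine hyperplane in A passing through c. Then vol_{d−2}(Δ ∩ H) / vol(Δ) ≥ 1/(2e). -/
open MeasureTheory
open scoped ENNReal

theorem volume_add_volume_le_of_add_mem {A B C : Set ℝ} (hA : MeasurableSet A)
    (hB : MeasurableSet B) (hA' : A.Nonempty) (hB' : B.Nonempty)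
    (h : ∀ a ∈ A, ∀ b ∈ B, a + b ∈ C) : volume A + volume B ≤ volume C := by
  have key : ∀ K ⊆ A, IsCompact K → K.Nonempty → ∀ L ⊆ B, IsCompact L → L.Nonempty →
      volume K + volume L ≤ volume C := by
    intro K hKA hK hKne L hLB hL hLne
    obtain ⟨p, hp, hpmax⟩ := hK.exists_isGreatest hKne
    obtain ⟨q, hq, hqmin⟩ := hL.exists_isLeast hLne
    have hdisj : AEDisjoint volume ((fun x => x + q) '' K) ((fun x => p + x) '' L) := by
      refine measure_mono_null (t := {p + q}) ?_ (by simp)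
      rintro _ ⟨⟨x, hx, rfl⟩, ⟨y, hy, hxy⟩⟩
      have h1 := hpmax hx
      have h2 := hqmin hy
      simp only at hxy
      simp only [Set.mem_singleton_iff]
      linarith
    calc volume K + volume L
        = volume ((fun x => x + q) '' K) + volume ((fun x => p + x) '' L) := by simp
      _ = volume ((fun x => x + q) '' K ∪ (fun x => p + x) '' L) :=
          (measure_union₀ ((hL.image (by fun_prop)).measurableSet.nullMeasurableSet) hdisj).symm
      _ ≤ volume C := by
          apply measure_mono
          rintro _ (⟨x, hx, rfl⟩ | ⟨x, hx, rfl⟩)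
          · exact h _ (hKA hx) _ (hLB hq)
          · exact h _ (hKA hp) _ (hLB hx)
  obtain ⟨a, ha⟩ := hA'
  obtain ⟨b, hb⟩ := hB'
  have key' : ∀ K ⊆ A, IsCompact K → ∀ L ⊆ B, IsCompact L →
      volume K + volume L ≤ volume C := by
    intro K hKA hK L hLB hL
    refine le_trans (add_le_add (measure_mono (Set.subset_insert a K))
      (measure_mono (Set.subset_insert b L))) ?_
    exact key _ (Set.insert_subset ha hKA) (hK.insert a) ⟨a, by simp⟩
      _ (Set.insert_subset hb hLB) (hL.insert b) ⟨b, by simp⟩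
  have step : ∀ K ⊆ A, IsCompact K → volume K + volume B ≤ volume C := by
    intro K hKA hK
    have hfin : volume K ≠ ∞ := hK.measure_lt_top.ne
    have : volume B ≤ volume C - volume K := by
      rw [hB.measure_eq_iSup_isCompact]
      refine iSup_le fun L => iSup_le fun hLB => iSup_le fun hL => ?_
      exact ENNReal.le_sub_of_add_le_left hfin (key' K hKA hK L hLB hL)
    calc volume K + volume B ≤ volume K + (volume C - volume K) := by gcongr
      _ = volume C := add_tsub_cancel_of_le
          (le_trans le_self_add (key' K hKA hK ∅ (Set.empty_subset _) isCompact_empty))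
  by_cases hfin : volume B = ∞
  · have := step ∅ (Set.empty_subset _) isCompact_empty
    simp only [measure_empty, zero_add, hfin, top_le_iff] at this
    simp [this]
  have : volume A ≤ volume C - volume B := by
    rw [hA.measure_eq_iSup_isCompact]
    refine iSup_le fun K => iSup_le fun hKA => iSup_le fun hK => ?_
    exact ENNReal.le_sub_of_add_le_right hfin (step K hKA hK)
  calc volume A + volume B ≤ (volume C - volume B) + volume B := by gcongr
    _ = volume C := tsub_add_cancel_of_le
        (by simpa using step ∅ (Set.empty_subset _) isCompact_empty)

theorem ENNReal.rpow_mul_rpow_le_weighted_add {a b : ℝ} (ha : 0 < a) (hb : 0 < b)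
    (hab : a + b = 1) (p q : ℝ≥0∞) :
    p ^ a * q ^ b ≤ ENNReal.ofReal a * p + ENNReal.ofReal b * q := by
  rcases eq_or_ne p ∞ with rfl | hp
  · simp [ENNReal.mul_top, ha]
  rcases eq_or_ne q ∞ with rfl | hq
  · simp [ENNReal.mul_top, hb]
  lift p to NNReal using hp
  lift q to NNReal using hq
  have := NNReal.geom_mean_le_arith_mean2_weighted a.toNNReal b.toNNReal p q
    (by rw [← Real.toNNReal_add ha.le hb.le, hab, Real.toNNReal_one])
  rw [Real.coe_toNNReal _ ha.le, Real.coe_toNNReal _ hb.le] at this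
  rw [← ENNReal.coe_rpow_of_nonneg _ ha.le, ← ENNReal.coe_rpow_of_nonneg _ hb.le]
  simp only [ENNReal.ofReal]
  exact_mod_cast this

/-- One-dimensional Prékopa–Leindler inequality for functions with supremum `1`. -/
theorem weighted_add_lintegral_le_of_normalized {a b : ℝ} (ha : 0 < a) (hb : 0 < b)
    (hab : a + b = 1) {f g h : ℝ → ℝ} (hf : Measurable f) (hg : Measurable g) (hh : Measurable h)
    (hf0 : ∀ x, 0 ≤ f x) (hg0 : ∀ x, 0 ≤ g x) (hh0 : ∀ x, 0 ≤ h x)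
    (hf1 : ∀ x, f x ≤ 1) (hg1 : ∀ x, g x ≤ 1)
    (hfs : ∀ t < 1, ∃ x, t < f x) (hgs : ∀ t < 1, ∃ x, t < g x)
    (H : ∀ x y, f x ^ a * g y ^ b ≤ h (a * x + b * y)) :
    ENNReal.ofReal a * (∫⁻ x, ENNReal.ofReal (f x)) +
      ENNReal.ofReal b * (∫⁻ x, ENNReal.ofReal (g x)) ≤ ∫⁻ x, ENNReal.ofReal (h x) := by
  have hmf : Measurable fun t : ℝ => volume {x | t < f x} :=
    Antitone.measurable fun s t hst => measure_mono fun x hx => lt_of_le_of_lt hst hx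
  have hmg : Measurable fun t : ℝ => volume {x | t < g x} :=
    Antitone.measurable fun s t hst => measure_mono fun x hx => lt_of_le_of_lt hst hx
  rw [lintegral_eq_lintegral_meas_lt _ (.of_forall hf0) hf.aemeasurable,
    lintegral_eq_lintegral_meas_lt _ (.of_forall hg0) hg.aemeasurable,
    lintegral_eq_lintegral_meas_lt _ (.of_forall hh0) hh.aemeasurable,
    ← lintegral_const_mul _ hmf, ← lintegral_const_mul _ hmg,
    ← lintegral_add_left (hmf.const_mul _)]
  refine setLIntegral_mono' measurableSet_Ioi fun t ht => ?_
  rw [Set.mem_Ioi] at ht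
  rcases lt_or_ge t 1 with ht1 | ht1
  · have hscale : ∀ {c : ℝ} (_ : 0 < c) (S : Set ℝ),
        ENNReal.ofReal c * volume S = volume ((fun x => c * x) '' S) := by
      intro c hc S
      have := Measure.addHaar_smul (volume : Measure ℝ) c S
      simp only [Module.finrank_self, pow_one, abs_of_pos hc] at this
      rw [← this]; rfl
    rw [hscale ha, hscale hb]
    have hme : ∀ {c : ℝ} (_ : 0 < c) {k : ℝ → ℝ} (_ : Measurable k),
        MeasurableSet ((fun x => c * x) '' {x | t < k x}) := by
      intro c hc k hk
      exact (measurableEmbedding_mulLeft₀ hc.ne').measurableSet_image.2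
        (measurableSet_lt measurable_const hk)
    refine volume_add_volume_le_of_add_mem (hme ha hf) (hme hb hg)
      (Set.Nonempty.image _ (hfs t ht1)) (Set.Nonempty.image _ (hgs t ht1)) ?_
    rintro _ ⟨x, hx, rfl⟩ _ ⟨y, hy, rfl⟩
    refine lt_of_lt_of_le ?_ (H x y)
    have h1 : t = t ^ a * t ^ b := by rw [← Real.rpow_add ht, hab, Real.rpow_one]
    calc t = t ^ a * t ^ b := h1
      _ < f x ^ a * g y ^ b := by
        have hx' : t < f x := hx
        have hy' : t < g y := hy
        gcongr
  · have e1 : {x | t < f x} = ∅ := by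
      ext x; simpa using (hf1 x).trans ht1
    have e2 : {x | t < g x} = ∅ := by
      ext x; simpa using (hg1 x).trans ht1
    simp [e1, e2]

/-- One-dimensional Prékopa–Leindler inequality for bounded functions. -/
theorem lintegral_rpow_mul_le_of_bounded {a b : ℝ} (ha : 0 < a) (hb : 0 < b)
    (hab : a + b = 1) {f g h : ℝ → ℝ≥0∞} (hf : Measurable f) (hg : Measurable g)
    (hh : Measurable h) {C : ℝ≥0∞} (hC : C ≠ ∞) (hfC : ∀ x, f x ≤ C) (hgC : ∀ x, g x ≤ C)
    (H : ∀ x y, f x ^ a * g y ^ b ≤ h (a * x + b * y)) :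
    (∫⁻ x, f x) ^ a * (∫⁻ x, g x) ^ b ≤ ∫⁻ x, h x := by
  set M := ⨆ x, f x with hM
  set N := ⨆ x, g x with hN
  have hfM : ∀ x, f x ≤ M := le_iSup f
  have hgN : ∀ x, g x ≤ N := le_iSup g
  have hMt : M ≠ ∞ := ne_top_of_le_ne_top hC (iSup_le hfC)
  have hNt : N ≠ ∞ := ne_top_of_le_ne_top hC (iSup_le hgC)
  rcases eq_or_ne M 0 with hM0 | hM0
  · have : ∀ x, f x = 0 := fun x => le_antisymm (hM0 ▸ hfM x) bot_le
    simp [this, ha]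
  rcases eq_or_ne N 0 with hN0 | hN0
  · have : ∀ x, g x = 0 := fun x => le_antisymm (hN0 ▸ hgN x) bot_le
    simp [this, hb]
  set D := M ^ a * N ^ b with hD
  have hD0 : D ≠ 0 := by simp [hD, hM0, hN0, hMt, hNt]
  have hDt : D ≠ ∞ := ENNReal.mul_ne_top (by simp [ha.le, hMt]) (by simp [hb.le, hNt])
  have hle1 : ∀ {k : ℝ → ℝ≥0∞} {P : ℝ≥0∞}, (∀ x, k x ≤ P) → ∀ x, k x / P ≤ 1 :=
    fun hk x => ENNReal.div_le_of_le_mul (by simpa using hk x)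
  have hsup : ∀ {k : ℝ → ℝ≥0∞} {P : ℝ≥0∞}, P = ⨆ x, k x → P ≠ 0 → P ≠ ∞ → (∀ x, k x ≤ P) →
      ∀ t < (1 : ℝ), ∃ x, t < (k x / P).toReal := by
    intro k P hP hP0 hPt hk t ht
    rcases lt_or_ge t 0 with ht0 | ht0
    · exact ⟨0, ht0.trans_le ENNReal.toReal_nonneg⟩
    have h1 : ENNReal.ofReal t * P < ⨆ x, k x := by
      rw [← hP]
      calc ENNReal.ofReal t * P < 1 * P := by
            refine (ENNReal.mul_lt_mul_iff_left hP0 hPt).2 ?_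
            simpa using ht
        _ = P := one_mul P
    obtain ⟨x, hx⟩ := lt_iSup_iff.1 h1
    refine ⟨x, ?_⟩
    rw [← ENNReal.ofReal_lt_iff_lt_toReal ht0 (ne_top_of_le_ne_top ENNReal.one_ne_top (hle1 hk x))]
    rwa [ENNReal.lt_div_iff_mul_lt (Or.inl hP0) (Or.inl hPt)]
  have key := weighted_add_lintegral_le_of_normalized ha hb hab
    (f := fun x => (f x / M).toReal) (g := fun x => (g x / N).toReal)
    (h := fun x => (min (h x / D) 1).toReal)
    (hf.div_const M).ennreal_toReal (hg.div_const N).ennreal_toReal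
    ((hh.div_const D).min measurable_const).ennreal_toReal
    (fun _ => ENNReal.toReal_nonneg) (fun _ => ENNReal.toReal_nonneg)
    (fun _ => ENNReal.toReal_nonneg)
    (fun x => ENNReal.toReal_le_of_le_ofReal zero_le_one (by simpa using hle1 hfM x))
    (fun x => ENNReal.toReal_le_of_le_ofReal zero_le_one (by simpa using hle1 hgN x))
    (hsup hM hM0 hMt hfM) (hsup hN hN0 hNt hgN) ?_
  · have hfin : ∀ {k : ℝ → ℝ≥0∞} {P : ℝ≥0∞}, (∀ x, k x ≤ P) → ∀ x,
        ENNReal.ofReal (k x / P).toReal = k x / P := fun hk x =>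
      ENNReal.ofReal_toReal (ne_top_of_le_ne_top ENNReal.one_ne_top (hle1 hk x))
    simp only [hfin hfM, hfin hgN] at key
    have h2 : ∫⁻ x, ENNReal.ofReal (min (h x / D) 1).toReal ≤ (∫⁻ x, h x) / D := by
      rw [div_eq_mul_inv, ← lintegral_mul_const _ hh]
      refine lintegral_mono fun x => ?_
      refine ENNReal.ofReal_toReal_le.trans ?_
      exact min_le_left _ _
    have h3 := (ENNReal.rpow_mul_rpow_le_weighted_add ha hb hab _ _).trans (key.trans h2)
    simp only [div_eq_mul_inv] at h3
    rw [lintegral_mul_const _ hf, lintegral_mul_const _ hg, ENNReal.mul_rpow_of_nonneg _ _ ha.le,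
      ENNReal.mul_rpow_of_nonneg _ _ hb.le, mul_mul_mul_comm, ENNReal.inv_rpow, ENNReal.inv_rpow,
      ← ENNReal.mul_inv (Or.inr (by simp [hb.le, hNt])) (Or.inl (by simp [ha.le, hMt])), ← hD,
      ← div_eq_mul_inv, ← div_eq_mul_inv] at h3
    rwa [ENNReal.div_le_iff hD0 hDt, ENNReal.div_mul_cancel hD0 hDt] at h3
  · intro x y
    rw [ENNReal.toReal_rpow, ENNReal.toReal_rpow, ← ENNReal.toReal_mul]
    refine ENNReal.toReal_mono (by simp) (le_min ?_ ?_)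
    · rw [ENNReal.div_rpow_of_nonneg _ _ ha.le, ENNReal.div_rpow_of_nonneg _ _ hb.le,
        div_eq_mul_inv, div_eq_mul_inv, mul_mul_mul_comm,
        ← ENNReal.mul_inv (Or.inr (by simp [hb.le, hNt])) (Or.inl (by simp [ha.le, hMt])), ← hD,
        ← div_eq_mul_inv]
      gcongr
      exact H x y
    · exact mul_le_one' (ENNReal.rpow_le_one (hle1 hfM x) ha.le)
        (ENNReal.rpow_le_one (hle1 hgN y) hb.le)

/-- One-dimensional Prékopa–Leindler inequality. -/
theorem lintegral_rpow_mul_le_real {a b : ℝ} (ha : 0 < a) (hb : 0 < b)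
    (hab : a + b = 1) {f g h : ℝ → ℝ≥0∞} (hf : Measurable f) (hg : Measurable g)
    (hh : Measurable h) (H : ∀ x y, f x ^ a * g y ^ b ≤ h (a * x + b * y)) :
    (∫⁻ x, f x) ^ a * (∫⁻ x, g x) ^ b ≤ ∫⁻ x, h x := by
  rcases eq_or_ne (∫⁻ x, f x) 0 with hf0 | hf0
  · simp [hf0, ha]
  rcases eq_or_ne (∫⁻ x, g x) 0 with hg0 | hg0
  · simp [hg0, hb]
  have htr : ∀ {k : ℝ → ℝ≥0∞}, Measurable k → Filter.Tendsto
      (fun n : ℕ => ∫⁻ x, min (k x) n) Filter.atTop (nhds (∫⁻ x, k x)) := by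
    intro k hk
    refine lintegral_tendsto_of_tendsto_of_monotone
      (fun n => (hk.min measurable_const).aemeasurable) (.of_forall fun x m n hmn => ?_)
      (.of_forall fun x => ?_)
    · exact min_le_min_left _ (by exact_mod_cast hmn)
    · have := (tendsto_const_nhds (x := k x)).min ENNReal.tendsto_nat_nhds_top
      simpa using this
  have hlim := ENNReal.Tendsto.mul ((ENNReal.continuous_rpow_const (y := a)).tendsto _ |>.comp
    (htr hf)) (Or.inl (by simp [hf0, ha.le]))
    ((ENNReal.continuous_rpow_const (y := b)).tendsto _ |>.comp (htr hg))
    (Or.inl (by simp [hg0, hb.le]))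
  refine le_of_tendsto hlim (.of_forall fun n => ?_)
  refine lintegral_rpow_mul_le_of_bounded ha hb hab (hf.min measurable_const)
    (hg.min measurable_const) hh (C := n) (by simp) (fun x => min_le_right _ _)
    (fun x => min_le_right _ _) fun x y => le_trans ?_ (H x y)
  gcongr <;> exact min_le_left _ _

theorem lintegral_fin_succ_eq {m : ℕ} {f : (Fin (m + 1) → ℝ) → ℝ≥0∞} (hf : Measurable f) :
    ∫⁻ x, f x = ∫⁻ s : ℝ, ∫⁻ z : Fin m → ℝ, f (Fin.cons s z) := by
  have h := (volume_preserving_piFinSuccAbove (fun _ : Fin (m + 1) => ℝ) 0).symm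
  rw [← h.lintegral_comp_emb (MeasurableEquiv.measurableEmbedding _), Measure.volume_eq_prod,
    lintegral_prod _ (by exact (hf.comp (MeasurableEquiv.measurable _)).aemeasurable)]
  simp [MeasurableEquiv.piFinSuccAbove_symm_apply, Fin.insertNthEquiv]

/-- The Prékopa–Leindler inequality. -/
theorem lintegral_rpow_mul_le_pi {a b : ℝ} (ha : 0 < a) (hb : 0 < b) (hab : a + b = 1) {m : ℕ}
    {f g h : (Fin m → ℝ) → ℝ≥0∞} (hf : Measurable f) (hg : Measurable g)
    (hh : Measurable h) (H : ∀ x y, f x ^ a * g y ^ b ≤ h (a • x + b • y)) :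
    (∫⁻ x, f x) ^ a * (∫⁻ x, g x) ^ b ≤ ∫⁻ x, h x := by
  induction m with
  | zero => 
    simp only [lintegral_unique, volume_pi, Measure.pi_univ, Finset.univ_eq_empty,
      Finset.prod_empty, mul_one]
    convert H default default
  | succ m ih =>
    have hcons : Measurable fun p : ℝ × (Fin m → ℝ) => (Fin.cons p.1 p.2 : Fin (m + 1) → ℝ) := by
      refine measurable_pi_lambda _ fun i => ?_
      refine Fin.cases ?_ (fun j => ?_) i
      · exact measurable_fst
      · simpa [Function.comp_def] using (measurable_pi_apply j).comp measurable_snd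
    have hmeas : ∀ {k : (Fin (m + 1) → ℝ) → ℝ≥0∞}, Measurable k →
        Measurable fun s : ℝ => ∫⁻ z : Fin m → ℝ, k (Fin.cons s z) :=
      fun hk => (hk.comp hcons).lintegral_prod_right'
    have hmeas' : ∀ {k : (Fin (m + 1) → ℝ) → ℝ≥0∞}, Measurable k → ∀ s : ℝ,
        Measurable fun z : Fin m → ℝ => k (Fin.cons s z) :=
      fun hk s => (hk.comp hcons).comp measurable_prodMk_left
    rw [lintegral_fin_succ_eq hf, lintegral_fin_succ_eq hg, lintegral_fin_succ_eq hh]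
    refine lintegral_rpow_mul_le_real ha hb hab (hmeas hf) (hmeas hg) (hmeas hh) fun s t => ?_
    refine ih (hmeas' hf s) (hmeas' hg t) (hmeas' hh _) fun x y => ?_
    convert H (Fin.cons s x) (Fin.cons t y) using 2
    funext i
    refine Fin.cases ?_ (fun j => ?_) i <;> simp

/-- The volumes of the parallel slices of a convex set form a log-concave function. -/
theorem Convex.volume_slice_rpow_mul_le {m : ℕ} {D : Set (ℝ × EuclideanSpace ℝ (Fin m))}
    (hD : Convex ℝ D) (hDm : MeasurableSet D) {a b : ℝ} (ha : 0 < a) (hb : 0 < b)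
    (hab : a + b = 1) (s t : ℝ) :
    volume (Prod.mk s ⁻¹' D) ^ a * volume (Prod.mk t ⁻¹' D) ^ b ≤
      volume (Prod.mk (a * s + b * t) ⁻¹' D) := by
  have hvol : ∀ r : ℝ, volume (Prod.mk r ⁻¹' D) =
      ∫⁻ z, (WithLp.toLp 2 ⁻¹' (Prod.mk r ⁻¹' D)).indicator 1 z := by
    intro r
    have hm := measurable_prodMk_left (x := r) hDm
    rw [lintegral_indicator_one (by exact (PiLp.volume_preserving_toLp (Fin m)).measurable hm),
      (PiLp.volume_preserving_toLp (Fin m)).measure_preimage hm.nullMeasurableSet]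
  have hmeas : ∀ r : ℝ, Measurable fun z : Fin m → ℝ =>
      ((WithLp.toLp 2 ⁻¹' (Prod.mk r ⁻¹' D)).indicator 1 z : ℝ≥0∞) := fun r =>
    measurable_one.indicator
      ((PiLp.volume_preserving_toLp (Fin m)).measurable (measurable_prodMk_left (x := r) hDm))
  rw [hvol, hvol, hvol]
  refine lintegral_rpow_mul_le_pi ha hb hab (hmeas s) (hmeas t) (hmeas _) fun x y => ?_
  by_cases hx : (s, WithLp.toLp 2 x) ∈ D
  · by_cases hy : (t, WithLp.toLp 2 y) ∈ D
    · have := hD hx hy ha.le hb.le hab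
      simp only [Prod.smul_mk, Prod.mk_add_mk, smul_eq_mul] at this
      rw [Set.indicator_of_mem (by exact hx), Set.indicator_of_mem (by exact hy),
        Set.indicator_of_mem (by exact this)]
      simp
    · rw [Set.indicator_of_notMem (a := y) (by exact hy)]
      simp [hb]
  · rw [Set.indicator_of_notMem (a := x) (by exact hx)]
    simp [ha]

/-- A log-concave function lies below an exponential touching it at an interior point of its
support. -/
theorem exists_le_mul_exp_of_logConcave {p : ℝ → ℝ} (hp : ∀ s, 0 ≤ p s)
    (hlog : ∀ a b : ℝ, 0 < a → 0 < b → a + b = 1 → ∀ s t,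
      p s ^ a * p t ^ b ≤ p (a * s + b * t))
    (h0 : 0 < p 0) (hr : ∃ s > 0, 0 < p s) (hl : ∃ s < 0, 0 < p s) :
    ∃ κ : ℝ, ∀ s, p s ≤ p 0 * Real.exp (κ * s) := by
  let slope : ℝ → ℝ := fun s => (Real.log (p s) - Real.log (p 0)) / s
  obtain ⟨κ, hκ₁, hκ₂⟩ := exists_between_of_forall_le
    (s := slope '' {s | 0 < s ∧ 0 < p s}) (t := slope '' {s | s < 0 ∧ 0 < p s})
    (by obtain ⟨s, hs⟩ := hr; exact ⟨_, s, hs, rfl⟩)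
    (by obtain ⟨s, hs⟩ := hl; exact ⟨_, s, hs, rfl⟩) (by
      rintro _ ⟨s, ⟨hs, hps⟩, rfl⟩ _ ⟨t, ⟨ht, hpt⟩, rfl⟩
      have hst : 0 < s - t := by linarith
      have h := hlog (-t / (s - t)) (s / (s - t)) (div_pos (by linarith) hst) (div_pos hs hst)
        (by field_simp; ring) s t
      rw [show -t / (s - t) * s + s / (s - t) * t = 0 by ring] at h
      have h' := Real.log_le_log (by positivity) h
      rw [Real.log_mul (by positivity) (by positivity), Real.log_rpow hps, Real.log_rpow hpt] at h'
      have h'' : -t * Real.log (p s) + s * Real.log (p t) ≤ (s - t) * Real.log (p 0) := by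
        have := mul_le_mul_of_nonneg_left h' hst.le
        calc _ = (s - t) * (-t / (s - t) * Real.log (p s) + s / (s - t) * Real.log (p t)) := by
              field_simp
          _ ≤ _ := this
      simp only [slope]
      rw [div_le_iff₀ hs, div_mul_eq_mul_div, le_div_iff_of_neg ht]
      linarith)
  refine ⟨κ, fun s => ?_⟩
  rcases (hp s).eq_or_lt with hps | hps
  · rw [← hps]; positivity
  rw [← Real.log_le_log_iff hps (by positivity), Real.log_mul h0.ne' (by positivity),
    Real.log_exp]
  rcases lt_trichotomy s 0 with hs | rfl | hs
  · have := hκ₂ ⟨s, ⟨hs, hps⟩, rfl⟩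
    rw [le_div_iff_of_neg hs] at this
    linarith
  · simp
  · have := hκ₁ ⟨s, ⟨hs, hps⟩, rfl⟩
    rw [div_le_iff₀ hs] at this
    linarith

theorem sub_le_mul_log_sub_mul_log {x y : ℝ} (hx : 0 ≤ x) (hy : 0 < y) :
    x - y ≤ x * Real.log x - x * Real.log y := by
  rcases hx.eq_or_lt with rfl | hx
  · simp [hy.le]
  have h := Real.log_le_sub_one_of_pos (div_pos hy hx)
  rw [Real.log_div hy.ne' hx.ne'] at h
  have := mul_le_mul_of_nonneg_left h hx.le
  have e : x * (y / x - 1) = y - x := by field_simp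
  linarith

/-- A log-concave density on the line of total mass `V`, mean `0` and variance `σ²` is at least
`V / (σ √(2πe))` at its mean. -/
theorem mass_le_mul_density_at_mean {p : ℝ → ℝ} (hp : ∀ s, 0 ≤ p s) {V σ κ : ℝ} (hV : 0 < V)
    (hσ : 0 < σ) (h0 : 0 < p 0) (hκ : ∀ s, p s ≤ p 0 * Real.exp (κ * s))
    (hi0 : Integrable p) (hi1 : Integrable fun s => s * p s)
    (hi2 : Integrable fun s => s ^ 2 * p s)
    (hm0 : ∫ s, p s = V) (hm1 : ∫ s, s * p s = 0) (hm2 : ∫ s, s ^ 2 * p s = σ ^ 2 * V) :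
    V ≤ √(2 * Real.pi * Real.exp 1) * σ * p 0 := by
  set c := V / (√(2 * Real.pi) * σ) with hc
  have hcpos : 0 < c := by positivity
  have hint : Integrable fun s : ℝ => c * Real.exp (-(1 / (2 * σ ^ 2)) * s ^ 2) :=
    (integrable_exp_neg_mul_sq (by positivity)).const_mul c
  have hpt : ∀ s, Real.log c * p s - 1 / (2 * σ ^ 2) * (s ^ 2 * p s) + p s
      - c * Real.exp (-(1 / (2 * σ ^ 2)) * s ^ 2) ≤ Real.log (p 0) * p s + κ * (s * p s) := by
    intro s
    have h1 := sub_le_mul_log_sub_mul_log (hp s)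
      (y := c * Real.exp (-(1 / (2 * σ ^ 2)) * s ^ 2)) (by positivity)
    rw [Real.log_mul hcpos.ne' (by positivity), Real.log_exp] at h1
    have h2 : p s * Real.log (p s) ≤ p s * (Real.log (p 0) + κ * s) := by
      rcases (hp s).eq_or_lt with hps | hps
      · simp [← hps]
      have := Real.log_le_log hps (hκ s)
      rw [Real.log_mul h0.ne' (by positivity), Real.log_exp] at this
      gcongr
    linarith
  have h := integral_mono ((((hi0.const_mul _).sub (hi2.const_mul _)).add hi0).sub hint)
    ((hi0.const_mul _).add (hi1.const_mul κ)) hpt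
  simp only [Pi.add_apply, Pi.sub_apply] at h
  rw [integral_sub (by exact ((hi0.const_mul _).sub (hi2.const_mul _)).add hi0) hint,
    integral_add (by exact (hi0.const_mul _).sub (hi2.const_mul _)) hi0,
    integral_sub (hi0.const_mul _) (hi2.const_mul _),
    integral_add (hi0.const_mul _) (hi1.const_mul κ)] at h
  simp only [integral_const_mul, integral_gaussian, hm0, hm1, hm2] at h
  have hg : c * √(Real.pi / (1 / (2 * σ ^ 2))) = V := by
    rw [show Real.pi / (1 / (2 * σ ^ 2)) = (2 * Real.pi) * σ ^ 2 by field_simp,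
      Real.sqrt_mul (by positivity), Real.sqrt_sq hσ.le, hc]
    field_simp
  rw [hg] at h
  have h3 : Real.log c - 1 / 2 ≤ Real.log (p 0) := by
    have e : 1 / (2 * σ ^ 2) * (σ ^ 2 * V) = 1 / 2 * V := by field_simp
    rw [e] at h
    refine le_of_mul_le_mul_right ?_ hV
    linarith
  have h4 : c ≤ p 0 * √(Real.exp 1) := by
    have : Real.log c ≤ Real.log (p 0 * √(Real.exp 1)) := by
      rw [Real.log_mul h0.ne' (by positivity), Real.log_sqrt (by positivity), Real.log_exp]
      linarith
    exact (Real.log_le_log_iff hcpos (by positivity)).1 this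
  rw [Real.sqrt_mul (by positivity)]
  calc V = √(2 * Real.pi) * σ * c := by rw [hc]; field_simp
    _ ≤ √(2 * Real.pi) * σ * (p 0 * √(Real.exp 1)) := by gcongr
    _ = _ := by ring

theorem Real.sqrt_one_add_inv_pow_le (n : ℕ) : √(1 + 1 / (n : ℝ)) ^ n ≤ √(Real.exp 1) := by
  rcases Nat.eq_zero_or_pos n with rfl | hn
  · simp
  have hn' : (0 : ℝ) < n := by exact_mod_cast hn
  refine Real.le_sqrt_of_sq_le ?_
  rw [← pow_mul, mul_comm, pow_mul, Real.sq_sqrt (by positivity)]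
  calc (1 + 1 / (n : ℝ)) ^ n ≤ (Real.exp (1 / n)) ^ n := by
        gcongr
        linarith [Real.add_one_le_exp (1 / (n : ℝ))]
    _ = Real.exp 1 := by
        rw [← Real.exp_nat_mul]
        congr 1
        field_simp

theorem ediam_prod_slab_le {X : Type*} [SeminormedAddCommGroup X] (t : Set X) {D h c : ℝ} (hD : 0 ≤ D)
    (ht : Metric.ediam t ≤ ENNReal.ofReal D) :
    Metric.ediam {w : WithLp 2 (ℝ × X) | w.fst ∈ Set.Icc c (c + h) ∧ w.snd ∈ t} ≤
      ENNReal.ofReal (√(h ^ 2 + D ^ 2)) := by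
  refine Metric.ediam_le fun x hx y hy => ?_
  rw [edist_dist, WithLp.prod_dist_eq_of_L2]
  refine ENNReal.ofReal_le_ofReal (Real.sqrt_le_sqrt (add_le_add ?_ ?_))
  · have : dist x.fst y.fst ≤ h := by
      have := Real.dist_le_of_mem_Icc hx.1 hy.1
      linarith
    gcongr
  · have h1 := (Metric.edist_le_ediam_of_mem hx.2 hy.2).trans ht
    rw [edist_dist, ENNReal.ofReal_le_ofReal_iff hD] at h1
    gcongr

theorem exists_thickened_diameter {d r : ℝ} (hd : 0 ≤ d) (hr : 0 < r) (m : ℕ) {δ : ℝ}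
    (hδ : 0 < δ) : ∃ D, 0 < D ∧ d ≤ D ∧ D ≤ d + r ∧ D ^ m ≤ d ^ m + δ := by
  have hc : Filter.Tendsto (fun x : ℝ => (d + x) ^ m) (nhdsWithin 0 (Set.Ioi 0)) (nhds (d ^ m)) := by
    have : ContinuousAt (fun x : ℝ => (d + x) ^ m) 0 := by fun_prop
    simpa using this.tendsto.mono_left nhdsWithin_le_nhds
  have h1 := hc.eventually (gt_mem_nhds (show d ^ m < d ^ m + δ by linarith))
  have h2 : ∀ᶠ x in nhdsWithin (0 : ℝ) (Set.Ioi 0), x < r :=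
    nhdsWithin_le_nhds (gt_mem_nhds hr)
  obtain ⟨x, hx, hxr, hx0⟩ := (h1.and (h2.and self_mem_nhdsWithin)).exists
  exact ⟨d + x, by linarith, by linarith, by linarith, hx.le⟩

/-- Slicing a prism over `t` into almost optimal slabs. -/
theorem exists_prism_cover {X : Type*} [SeminormedAddCommGroup X] (t : Set X) (m : ℕ) {r : ℝ}
    (hr : 0 < r) (ht : Metric.ediam t ≤ ENNReal.ofReal r) {δ : ℝ} (hδ : 0 < δ) :
    ∃ T : ℕ → Set (WithLp 2 (ℝ × X)),
      {w | w.fst ∈ Set.Icc 0 1 ∧ w.snd ∈ t} ⊆ ⋃ j, T j ∧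
      (∀ j, Metric.ediam (T j) ≤ ENNReal.ofReal (4 * r)) ∧
      ∑' j, Metric.ediam (T j) ^ ((m + 1 : ℕ) : ℝ) ≤
        ENNReal.ofReal (√(Real.exp 1 * (m + 1 : ℕ)) * (1 + 2 * r)) *
          ((⨆ _ : t.Nonempty, Metric.ediam t ^ (m : ℝ)) + ENNReal.ofReal δ) := by
  rcases t.eq_empty_or_nonempty with rfl | hne
  · refine ⟨fun _ => ∅, ?_, ?_, ?_⟩
    · rintro w ⟨_, h⟩
      exact h.elim
    · simp
    · simp [ENNReal.zero_rpow_of_pos (by positivity : (0 : ℝ) < (m : ℝ) + 1)]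
  set n := m + 1 with hn
  have hn0 : (0 : ℝ) < n := by positivity
  have hn1 : (1 : ℝ) ≤ n := by rw [hn]; push_cast; linarith [(Nat.cast_nonneg m : (0 : ℝ) ≤ m)]
  have htfin : Metric.ediam t ≠ ∞ := ne_top_of_le_ne_top ENNReal.ofReal_ne_top ht
  set d := (Metric.ediam t).toReal with hd
  have hdt : Metric.ediam t = ENNReal.ofReal d := (ENNReal.ofReal_toReal htfin).symm
  have hdr : d ≤ r := ENNReal.toReal_le_of_le_ofReal hr.le ht
  obtain ⟨D, hD, hdD, hDr, hDm⟩ := exists_thickened_diameter (d := d) ENNReal.toReal_nonneg hr m hδ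
  set h := D / √n with hh
  have hsn : 0 < √(n : ℝ) := Real.sqrt_pos.2 hn0
  have hh0 : 0 < h := by positivity
  set N := ⌊1 / h⌋₊ + 1 with hN
  have hNle : (N : ℝ) ≤ 1 / h + 1 := by
    rw [hN]; push_cast
    linarith [Nat.floor_le (show 0 ≤ 1 / h by positivity)]
  have hdiag : √(h ^ 2 + D ^ 2) = D * √(1 + 1 / (n : ℝ)) := by
    rw [show h ^ 2 + D ^ 2 = D ^ 2 * (1 + 1 / (n : ℝ)) by
      rw [hh, div_pow, Real.sq_sqrt hn0.le]; ring, Real.sqrt_mul (by positivity),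
      Real.sqrt_sq hD.le]
  have hslab : ∀ c : ℝ, Metric.ediam {w : WithLp 2 (ℝ × X) | w.fst ∈ Set.Icc c (c + h) ∧ w.snd ∈ t}
      ≤ ENNReal.ofReal (D * √(1 + 1 / (n : ℝ))) := fun c => by
    rw [← hdiag]
    exact ediam_prod_slab_le t hD.le (hdt.trans_le (ENNReal.ofReal_le_ofReal hdD))
  refine ⟨fun j => if j < N then {w | w.fst ∈ Set.Icc (j * h) (j * h + h) ∧ w.snd ∈ t} else ∅,
    ?_, ?_, ?_⟩
  · rintro w ⟨⟨hw0, hw1⟩, hw⟩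
    have hfl : ⌊w.fst / h⌋₊ < N :=
      Nat.lt_succ_of_le (Nat.floor_le_floor (by gcongr))
    refine Set.mem_iUnion.2 ⟨⌊w.fst / h⌋₊, ?_⟩
    rw [if_pos hfl]
    refine ⟨⟨?_, ?_⟩, hw⟩
    · rw [← le_div_iff₀ hh0]
      exact Nat.floor_le (by positivity)
    · have := Nat.lt_floor_add_one (w.fst / h)
      rw [div_lt_iff₀ hh0] at this
      linarith
  · intro j
    beta_reduce
    split_ifs
    · refine (hslab _).trans (ENNReal.ofReal_le_ofReal ?_)
      have : √(1 + 1 / (n : ℝ)) ≤ 2 := by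
        rw [Real.sqrt_le_left (by norm_num)]
        have : 1 / (n : ℝ) ≤ 1 := by rw [div_le_one hn0]; exact hn1
        linarith
      nlinarith [Real.sqrt_nonneg (1 + 1 / (n : ℝ))]
    · simp
  · rw [tsum_eq_sum (s := Finset.range N) (by
      intro j hj
      rw [Finset.mem_range] at hj
      beta_reduce
      rw [if_neg hj, Metric.ediam_empty, ENNReal.zero_rpow_of_pos hn0])]
    calc ∑ j ∈ Finset.range N, Metric.ediam (if j < N then {w : WithLp 2 (ℝ × X) |
            w.fst ∈ Set.Icc (j * h) (j * h + h) ∧ w.snd ∈ t} else ∅) ^ (n : ℝ)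
        ≤ ∑ j ∈ Finset.range N, ENNReal.ofReal (D * √(1 + 1 / (n : ℝ))) ^ (n : ℝ) := by
          refine Finset.sum_le_sum fun j hj => ?_
          rw [if_pos (Finset.mem_range.1 hj)]
          exact ENNReal.rpow_le_rpow (hslab _) hn0.le
      _ = ENNReal.ofReal (N * (D * √(1 + 1 / (n : ℝ))) ^ n) := by
          rw [Finset.sum_const, Finset.card_range, nsmul_eq_mul, ENNReal.rpow_natCast,
            ← ENNReal.ofReal_pow (by positivity), ENNReal.ofReal_mul (by positivity),
            ENNReal.ofReal_natCast]
      _ ≤ ENNReal.ofReal (√(Real.exp 1 * n) * (1 + 2 * r) * (d ^ m + δ)) := by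
          refine ENNReal.ofReal_le_ofReal ?_
          rw [mul_pow]
          calc N * (D ^ n * √(1 + 1 / (n : ℝ)) ^ n)
              ≤ (1 / h + 1) * (D ^ n * √(Real.exp 1)) := by
                gcongr
                exact Real.sqrt_one_add_inv_pow_le n
            _ = √(Real.exp 1) * (√n + D) * D ^ m := by
                rw [hh, hn, pow_succ]; field_simp
            _ ≤ √(Real.exp 1) * (√n * (1 + 2 * r)) * (d ^ m + δ) := by
                gcongr
                have : 1 ≤ √(n : ℝ) := Real.one_le_sqrt.2 hn1
                nlinarith
            _ = _ := by rw [Real.sqrt_mul (by positivity)]; ring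
      _ = _ := by
          rw [ENNReal.ofReal_mul (by positivity), ENNReal.ofReal_add (by positivity) hδ.le,
            ciSup_pos hne, hdt, ENNReal.ofReal_pow ENNReal.toReal_nonneg, ENNReal.rpow_natCast]

/-- Comparison of the Hausdorff measures of a set and of the unit-height prism over it. -/
theorem hausdorffMeasure_prism_le {X : Type*} [NormedAddCommGroup X] [MeasurableSpace X] [BorelSpace X]
    [MeasurableSpace (WithLp 2 (ℝ × X))] [BorelSpace (WithLp 2 (ℝ × X))] (m : ℕ) {Q : Set X}
    (hQ : μH[(m : ℝ)] Q ≠ ∞) :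
    μH[((m + 1 : ℕ) : ℝ)] {w : WithLp 2 (ℝ × X) | w.fst ∈ Set.Icc 0 1 ∧ w.snd ∈ Q} ≤
      ENNReal.ofReal (√(Real.exp 1 * (m + 1 : ℕ))) * μH[(m : ℝ)] Q := by
  have hcover : ∀ r : ℝ, 0 < r → ∃ T : ℕ × ℕ → Set (WithLp 2 (ℝ × X)),
      {w | w.fst ∈ Set.Icc 0 1 ∧ w.snd ∈ Q} ⊆ ⋃ j, T j ∧
      (∀ j, Metric.ediam (T j) ≤ ENNReal.ofReal (4 * r)) ∧
      ∑' j, Metric.ediam (T j) ^ ((m + 1 : ℕ) : ℝ) ≤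
        ENNReal.ofReal (√(Real.exp 1 * (m + 1 : ℕ)) * (1 + 2 * r)) *
          (μH[(m : ℝ)] Q + ENNReal.ofReal r + ENNReal.ofReal r) := by
    intro r hr
    have hr' : ENNReal.ofReal r ≠ 0 := by simpa using hr
    have hlt : (⨅ (t : ℕ → Set X) (_ : Q ⊆ ⋃ n, t n)
        (_ : ∀ n, Metric.ediam (t n) ≤ ENNReal.ofReal r),
        ∑' n, ⨆ _ : (t n).Nonempty, Metric.ediam (t n) ^ (m : ℝ)) <
          μH[(m : ℝ)] Q + ENNReal.ofReal r := by
      refine lt_of_le_of_lt ?_ (ENNReal.lt_add_right hQ hr')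
      rw [Measure.hausdorffMeasure_apply]
      exact le_iSup₂_of_le (ENNReal.ofReal r) (pos_iff_ne_zero.2 hr') le_rfl
    simp only [iInf_lt_iff] at hlt
    obtain ⟨t, htQ, htd, htsum⟩ := hlt
    obtain ⟨δ, hδ, hδsum⟩ := ENNReal.exists_pos_sum_of_countable hr' ℕ
    choose T hTcov hTd hTsum using fun i => exists_prism_cover (t i) m hr (htd i)
      (δ := δ i) (by exact_mod_cast hδ i)
    refine ⟨fun p => T p.1 p.2, ?_, fun p => hTd p.1 p.2, ?_⟩
    · rintro w ⟨hw, hwQ⟩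
      obtain ⟨i, hi⟩ := Set.mem_iUnion.1 (htQ hwQ)
      obtain ⟨j, hj⟩ := Set.mem_iUnion.1 (hTcov i ⟨hw, hi⟩)
      exact Set.mem_iUnion.2 ⟨(i, j), hj⟩
    · rw [ENNReal.tsum_prod (f := fun i j => Metric.ediam (T i j) ^ ((m + 1 : ℕ) : ℝ))]
      refine (ENNReal.tsum_le_tsum hTsum).trans ?_
      rw [ENNReal.tsum_mul_left, ENNReal.tsum_add]
      simp only [ENNReal.ofReal_coe_nnreal]
      gcongr
  let r : ℕ → ℝ := fun N => 1 / ((N : ℝ) + 1)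
  have hr : ∀ N, 0 < r N := fun N => by positivity
  have hrt : Filter.Tendsto r Filter.atTop (nhds 0) := tendsto_one_div_add_atTop_nhds_zero_nat
  choose T hTcov hTd hTsum using fun N => hcover (r N) (hr N)
  have hlim : Filter.Tendsto (fun N => ENNReal.ofReal (√(Real.exp 1 * (m + 1 : ℕ)) * (1 + 2 * r N)) *
      (μH[(m : ℝ)] Q + ENNReal.ofReal (r N) + ENNReal.ofReal (r N))) Filter.atTop
      (nhds (ENNReal.ofReal (√(Real.exp 1 * (m + 1 : ℕ))) * μH[(m : ℝ)] Q)) := by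
    have h1 : Filter.Tendsto (fun N => ENNReal.ofReal (r N)) Filter.atTop (nhds 0) := by
      simpa using ENNReal.tendsto_ofReal hrt
    have h2 : Filter.Tendsto (fun N => √(Real.exp 1 * (m + 1 : ℕ)) * (1 + 2 * r N)) Filter.atTop
        (nhds (√(Real.exp 1 * (m + 1 : ℕ)))) := by
      simpa using ((hrt.const_mul 2).const_add 1).const_mul (√(Real.exp 1 * (m + 1 : ℕ)))
    have h3 : Filter.Tendsto (fun N => μH[(m : ℝ)] Q + ENNReal.ofReal (r N) + ENNReal.ofReal (r N))
        Filter.atTop (nhds (μH[(m : ℝ)] Q)) := by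
      simpa using (tendsto_const_nhds.add h1).add h1
    exact ENNReal.Tendsto.mul (ENNReal.tendsto_ofReal h2) (Or.inr hQ) h3
      (Or.inr ENNReal.ofReal_ne_top)
  have hdiam : Filter.Tendsto (fun N => ENNReal.ofReal (4 * r N)) Filter.atTop (nhds 0) := by
    simpa using ENNReal.tendsto_ofReal (hrt.const_mul 4)
  refine (Measure.hausdorffMeasure_le_liminf_tsum _ _ _ hdiam T (.of_forall hTd)
    (.of_forall hTcov)).trans ?_
  rw [← hlim.liminf_eq]
  exact Filter.liminf_le_liminf (.of_forall hTsum)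

/-- The Hausdorff measures of `ℝ × ℝᵐ` and `ℝᵐ` as multiples of Lebesgue measure. -/
theorem exists_hausdorffMeasure_eq_smul_volume (m : ℕ) : ∃ k k' : ℝ≥0∞,
    k ≠ ∞ ∧ k ≠ 0 ∧ k' ≠ ∞ ∧
    (μH[(m : ℝ)] : Measure (EuclideanSpace ℝ (Fin m))) = k' • volume ∧
    (∀ D : Set (ℝ × EuclideanSpace ℝ (Fin m)), MeasurableSet D →
      (μH[((m + 1 : ℕ) : ℝ)] : Measure (WithLp 2 (ℝ × EuclideanSpace ℝ (Fin m))))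
        (WithLp.ofLp ⁻¹' D) = k * volume D) ∧
    k ≤ ENNReal.ofReal (√(Real.exp 1 * (m + 1 : ℕ))) * k' := by
  let E := EuclideanSpace ℝ (Fin m)
  have hfr : Module.finrank ℝ E = m := by simp [E]
  have hfr' : Module.finrank ℝ (WithLp 2 (ℝ × E)) = m + 1 := by
    rw [(WithLp.linearEquiv 2 ℝ (ℝ × E)).finrank_eq, Module.finrank_prod, hfr,
      Module.finrank_self, add_comm]
  have hH : (μH[(m : ℝ)] : Measure E).IsAddHaarMeasure := by
    have := MeasureTheory.isAddHaarMeasure_hausdorffMeasure (E := E)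
    rwa [hfr] at this
  have hH' : (μH[((m + 1 : ℕ) : ℝ)] : Measure (WithLp 2 (ℝ × E))).IsAddHaarMeasure := by
    have := MeasureTheory.isAddHaarMeasure_hausdorffMeasure (E := WithLp 2 (ℝ × E))
    rwa [hfr'] at this
  let e : WithLp 2 (ℝ × E) ≃L[ℝ] ℝ × E := WithLp.prodContinuousLinearEquiv 2 ℝ ℝ E
  have hmap : ((μH[((m + 1 : ℕ) : ℝ)] : Measure (WithLp 2 (ℝ × E))).map e).IsAddHaarMeasure :=
    e.isAddHaarMeasure_map _
  have hvol : (volume : Measure (ℝ × E)).IsAddHaarMeasure :=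
    inferInstanceAs ((volume : Measure ℝ).prod (volume : Measure E)).IsAddHaarMeasure
  have h1 := Measure.isAddLeftInvariant_eq_smul (μH[(m : ℝ)] : Measure E) volume
  have h2 := Measure.isAddLeftInvariant_eq_smul
    ((μH[((m + 1 : ℕ) : ℝ)] : Measure (WithLp 2 (ℝ × E))).map e) volume
  set k' := Measure.addHaarScalarFactor (μH[(m : ℝ)] : Measure E) volume
  set k := Measure.addHaarScalarFactor
    ((μH[((m + 1 : ℕ) : ℝ)] : Measure (WithLp 2 (ℝ × E))).map e) volume with hk
  have hD : ∀ D : Set (ℝ × E), MeasurableSet D →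
      (μH[((m + 1 : ℕ) : ℝ)] : Measure (WithLp 2 (ℝ × E))) (WithLp.ofLp ⁻¹' D)
        = k * volume D := by
    intro D hD
    have := congrArg (fun μ : Measure (ℝ × E) => μ D) h2
    simp only [Measure.smul_apply] at this
    rw [Measure.map_apply e.continuous.measurable hD] at this
    exact this
  refine ⟨k, k', ENNReal.coe_ne_top, ?_, ENNReal.coe_ne_top, h1, hD, ?_⟩
  · exact_mod_cast (Measure.addHaarScalarFactor_pos_of_isAddHaarMeasure _ _).ne'
  · let Q : Set E := Metric.closedBall 0 1
    have hQ0 : volume Q ≠ 0 := (Metric.measure_closedBall_pos _ _ one_pos).ne'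
    have hQt : volume Q ≠ ∞ := measure_closedBall_lt_top.ne
    have hpr := hausdorffMeasure_prism_le m (Q := Q) (by
      rw [h1, Measure.smul_apply]
      exact ENNReal.mul_ne_top ENNReal.coe_ne_top hQt)
    have hpr' := hD (Set.Icc 0 1 ×ˢ Q) (measurableSet_Icc.prod measurableSet_closedBall)
    rw [Measure.volume_eq_prod, Measure.prod_prod, Real.volume_Icc] at hpr'
    have heq : {w : WithLp 2 (ℝ × E) | w.fst ∈ Set.Icc 0 1 ∧ w.snd ∈ Q} =
        WithLp.ofLp ⁻¹' (Set.Icc (0 : ℝ) 1 ×ˢ Q) := rfl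
    rw [heq, hpr', h1, Measure.smul_apply] at hpr
    simp only [sub_zero, ENNReal.ofReal_one, one_mul, ENNReal.smul_def, smul_eq_mul] at hpr
    rw [← mul_assoc] at hpr
    exact (ENNReal.mul_le_mul_iff_left hQ0 hQt).1 hpr

/-- A lower bound for the Hausdorff measure of the hyperplane section through the mean of a
convex body, in terms of the second moment in the normal direction. -/
theorem hausdorffMeasure_le_mul_central_section {m : ℕ}
    {D : Set (ℝ × EuclideanSpace ℝ (Fin m))} (hD : Convex ℝ D) (hDo : IsOpen D)
    (hDb : Bornology.IsBounded D) (h0 : (0, 0) ∈ D) {σ : ℝ} (hσ : 0 < σ)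
    (hm1 : ∫ w in (WithLp.ofLp ⁻¹' D : Set (WithLp 2 (ℝ × EuclideanSpace ℝ (Fin m)))),
      w.fst ∂μH[((m + 1 : ℕ) : ℝ)] = 0)
    (hm2 : ∫ w in (WithLp.ofLp ⁻¹' D : Set (WithLp 2 (ℝ × EuclideanSpace ℝ (Fin m)))),
      w.fst ^ 2 ∂μH[((m + 1 : ℕ) : ℝ)] = σ ^ 2 * μH[((m + 1 : ℕ) : ℝ)].real
        (WithLp.ofLp ⁻¹' D : Set (WithLp 2 (ℝ × EuclideanSpace ℝ (Fin m))))) :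
    μH[((m + 1 : ℕ) : ℝ)] (WithLp.ofLp ⁻¹' D : Set (WithLp 2 (ℝ × EuclideanSpace ℝ (Fin m)))) ≤
      ENNReal.ofReal (√(2 * Real.pi * Real.exp 1) * σ * √(Real.exp 1 * (m + 1 : ℕ))) *
        μH[(m : ℝ)] (Prod.mk 0 ⁻¹' D) := by
  obtain ⟨k, k', hk, hk0, hk', h1, h2, hkk⟩ := exists_hausdorffMeasure_eq_smul_volume m
  let E := EuclideanSpace ℝ (Fin m)
  have hDm := hDo.measurableSet
  set S : Set (WithLp 2 (ℝ × E)) := WithLp.ofLp ⁻¹' D with hS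
  have hofLp : Measurable (WithLp.ofLp : WithLp 2 (ℝ × E) → ℝ × E) :=
    (WithLp.prodContinuousLinearEquiv 2 ℝ ℝ E).continuous.measurable
  have hSm : MeasurableSet S := hofLp hDm
  have hfst : Measurable fun w : WithLp 2 (ℝ × E) => w.fst := measurable_fst.comp hofLp
  let q : ℝ → ℝ≥0∞ := fun s => k * volume (Prod.mk s ⁻¹' D)
  have hqm : Measurable q := (measurable_measure_prodMk_left hDm).const_mul k
  obtain ⟨R, hR⟩ := hDb.subset_closedBall 0
  have hslice : ∀ s, Prod.mk s ⁻¹' D ⊆ Metric.closedBall 0 R := by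
    intro s z hz
    have := hR hz
    rw [mem_closedBall_zero_iff] at this ⊢
    exact (norm_snd_le (s, z)).trans this
  have hqt : ∀ s, q s ≠ ∞ := fun s => ENNReal.mul_ne_top hk
    (ne_top_of_le_ne_top measure_closedBall_lt_top.ne (measure_mono (hslice s)))
  have hVt : μH[((m + 1 : ℕ) : ℝ)] S ≠ ∞ := by
    rw [hS, h2 D hDm]
    exact ENNReal.mul_ne_top hk hDb.measure_lt_top.ne
  have hV0 : μH[((m + 1 : ℕ) : ℝ)] S ≠ 0 := by
    rw [hS, h2 D hDm]
    exact mul_ne_zero hk0 (hDo.measure_pos volume ⟨_, h0⟩).ne'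
  have hν : (μH[((m + 1 : ℕ) : ℝ)].restrict S).map (fun w => w.fst) = volume.withDensity q := by
    ext T hT
    rw [Measure.map_apply hfst hT, Measure.restrict_apply (hfst hT), withDensity_apply _ hT,
      lintegral_const_mul _ (measurable_measure_prodMk_left hDm)]
    have : (fun w : WithLp 2 (ℝ × E) => w.fst) ⁻¹' T ∩ S =
      WithLp.ofLp ⁻¹' ((Prod.fst ⁻¹' T) ∩ D) := rfl
    rw [this, h2 _ ((measurable_fst hT).inter hDm), Measure.volume_eq_prod,
      Measure.prod_apply ((measurable_fst hT).inter hDm), ← lintegral_indicator hT]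
    congr 1
    refine lintegral_congr fun s => ?_
    by_cases hs : s ∈ T
    · rw [Set.indicator_of_mem hs]
      congr 1
      ext z
      simp [hs]
    · rw [Set.indicator_of_notMem hs]
      convert measure_empty (μ := (volume : Measure E))
      ext z
      simp [hs]
  let p : ℝ → ℝ := fun s => (q s).toReal
  have hfin : IsFiniteMeasure (μH[((m + 1 : ℕ) : ℝ)].restrict S) :=
    ⟨by simpa using hVt.lt_top⟩
  have hint : ∀ φ : ℝ → ℝ, Continuous φ → Integrable (fun s => φ s * p s) ∧
      ∫ s, φ s * p s = ∫ w in S, φ w.fst ∂μH[((m + 1 : ℕ) : ℝ)] := by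
    intro φ hφ
    constructor
    · have hbdd : Integrable (fun w : WithLp 2 (ℝ × E) => φ w.fst)
          (μH[((m + 1 : ℕ) : ℝ)].restrict S) := by
        obtain ⟨C, hC⟩ := (isCompact_Icc (a := -R) (b := R)).exists_bound_of_continuousOn
          hφ.continuousOn
        refine Integrable.of_bound (hφ.measurable.comp hfst).aestronglyMeasurable C ?_
        refine (ae_restrict_iff' hSm).2 (.of_forall fun w hw => hC _ ?_)
        have := hR hw
        rw [mem_closedBall_zero_iff] at this
        exact abs_le.1 ((norm_fst_le (WithLp.ofLp w)).trans this)
      have hb2 : Integrable φ (volume.withDensity q) := by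
        rw [← hν]
        exact (integrable_map_measure hφ.aestronglyMeasurable hfst.aemeasurable).2 hbdd
      rwa [integrable_withDensity_iff hqm (.of_forall fun s => (hqt s).lt_top)] at hb2
    · rw [← integral_map (φ := fun w : WithLp 2 (ℝ × E) => w.fst) hfst.aemeasurable
        (f := φ) hφ.aestronglyMeasurable, hν,
        integral_withDensity_eq_integral_toReal_smul hqm (.of_forall fun s => (hqt s).lt_top)]
      simp only [smul_eq_mul, p, mul_comm]
  have hp : ∀ s, 0 ≤ p s := fun s => ENNReal.toReal_nonneg
  have hslo : ∀ s, IsOpen (Prod.mk s ⁻¹' D) := fun s => hDo.preimage (by fun_prop)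
  have hpos : ∀ s, (s, (0 : E)) ∈ D → 0 < p s := fun s hs => ENNReal.toReal_pos
    (mul_ne_zero hk0 ((hslo s).measure_pos volume ⟨_, hs⟩).ne') (hqt s)
  have hnhds : ∀ᶠ s in nhds (0 : ℝ), (s, (0 : E)) ∈ D :=
    (Continuous.continuousAt (f := fun s : ℝ => (s, (0 : E))) (by fun_prop)).eventually
      (hDo.mem_nhds h0)
  obtain ⟨ε, hε, hεD⟩ := Metric.eventually_nhds_iff.1 hnhds
  have hlog : ∀ a b : ℝ, 0 < a → 0 < b → a + b = 1 → ∀ s t,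
      p s ^ a * p t ^ b ≤ p (a * s + b * t) := by
    intro a b ha hb hab s t
    simp only [p, ENNReal.toReal_rpow, ← ENNReal.toReal_mul]
    refine ENNReal.toReal_mono (hqt _) ?_
    simp only [q]
    rw [ENNReal.mul_rpow_of_nonneg _ _ ha.le, ENNReal.mul_rpow_of_nonneg _ _ hb.le,
      mul_mul_mul_comm, ← ENNReal.rpow_add _ _ hk0 hk, hab, ENNReal.rpow_one]
    gcongr
    exact hD.volume_slice_rpow_mul_le hDm ha hb hab s t
  obtain ⟨κ, hκ⟩ := exists_le_mul_exp_of_logConcave hp hlog (hpos 0 h0)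
    ⟨ε / 2, by positivity, hpos _ (hεD (by simp [abs_of_pos hε, hε]))⟩
    ⟨-(ε / 2), by linarith, hpos _ (hεD (by simp [abs_of_pos hε, hε]))⟩
  have hi0 := hint (fun _ => 1) continuous_const
  have hi1 := hint (fun s => s) continuous_id
  have hi2 := hint (fun s => s ^ 2) (by fun_prop)
  simp only [one_mul] at hi0
  have hmain := mass_le_mul_density_at_mean hp (V := μH[((m + 1 : ℕ) : ℝ)].real S)
    (ENNReal.toReal_pos hV0 hVt) hσ (hpos 0 h0) hκ hi0.1 hi1.1 hi2.1
    (by rw [hi0.2]; simp) (hi1.2.trans hm1) (hi2.2.trans hm2)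
  rw [h1, Measure.smul_apply, smul_eq_mul]
  calc μH[((m + 1 : ℕ) : ℝ)] S
      = ENNReal.ofReal (μH[((m + 1 : ℕ) : ℝ)].real S) := (ENNReal.ofReal_toReal hVt).symm
    _ ≤ ENNReal.ofReal (√(2 * Real.pi * Real.exp 1) * σ * p 0) := ENNReal.ofReal_le_ofReal hmain
    _ = ENNReal.ofReal (√(2 * Real.pi * Real.exp 1) * σ) * (k * volume (Prod.mk 0 ⁻¹' D)) := by
        rw [ENNReal.ofReal_mul (by positivity)]
        congr 1
        exact ENNReal.ofReal_toReal (hqt 0)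
    _ ≤ ENNReal.ofReal (√(2 * Real.pi * Real.exp 1) * σ) *
          ((ENNReal.ofReal (√(Real.exp 1 * (m + 1 : ℕ))) * k') * volume (Prod.mk 0 ⁻¹' D)) := by
        gcongr
    _ = _ := by
        rw [ENNReal.ofReal_mul (by positivity : 0 ≤ √(2 * Real.pi * Real.exp 1) * σ)]
        ring

/-- The standard open simplex of dimension `n`. -/
def openSimplex (n : ℕ) : Set (EuclideanSpace ℝ (Fin (n + 1))) :=
  {x | (∑ i, x i = 1) ∧ ∀ i, 0 < x i}

namespace openSimplex

variable {n : ℕ}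

theorem le_one {x : EuclideanSpace ℝ (Fin (n + 1))} (hx : x ∈ openSimplex n) (i : Fin (n + 1)) :
    x i ≤ 1 :=
  hx.1 ▸ Finset.single_le_sum (fun j _ => (hx.2 j).le) (Finset.mem_univ i)

theorem isBounded : Bornology.IsBounded (openSimplex n) := by
  refine isBounded_iff_forall_norm_le.2 ⟨1, fun x hx => ?_⟩
  rw [← sq_le_one_iff₀ (norm_nonneg _), EuclideanSpace.real_norm_sq_eq, ← hx.1]
  exact Finset.sum_le_sum fun i _ => by nlinarith [hx.2 i, le_one hx i]

theorem measurableSet : MeasurableSet (openSimplex n) := by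
  have : openSimplex n = {x | ∑ i, x i = 1} ∩ ⋂ i, {x | 0 < x i} := by
    ext x; simp [openSimplex]
  rw [this]
  refine MeasurableSet.inter ?_ (MeasurableSet.iInter fun i => ?_)
  · exact (isClosed_eq (by fun_prop) continuous_const).measurableSet
  · exact (isOpen_lt continuous_const (by fun_prop)).measurableSet

theorem homothety_image (i : Fin (n + 1)) {t : ℝ} (ht0 : 0 ≤ t) (ht : t < 1) :
    AffineMap.homothety (EuclideanSpace.single i (1 : ℝ)) (1 - t) '' openSimplex n =
      {x | t < x i} ∩ openSimplex n := by
  have ht' : 0 < 1 - t := by linarith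
  have happ : ∀ (y : EuclideanSpace ℝ (Fin (n + 1))) j,
      AffineMap.homothety (EuclideanSpace.single i (1 : ℝ)) (1 - t) y j =
        (1 - t) * y j + if j = i then t else 0 := by
    intro y j
    simp only [AffineMap.homothety_apply, vsub_eq_sub, vadd_eq_add, PiLp.add_apply,
      PiLp.smul_apply, PiLp.sub_apply, PiLp.single_apply, smul_eq_mul]
    split_ifs <;> ring
  ext x
  constructor
  · rintro ⟨y, hy, rfl⟩
    refine ⟨?_, ?_, fun j => ?_⟩
    · rw [Set.mem_ofPred_eq, happ, if_pos rfl]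
      nlinarith [mul_pos ht' (hy.2 i)]
    · simp only [happ, Finset.sum_add_distrib, ← Finset.mul_sum, hy.1]
      simp
    · rw [happ]
      have := mul_pos ht' (hy.2 j)
      split_ifs <;> linarith
  · rintro ⟨hxt, hx⟩
    rw [Set.mem_ofPred_eq] at hxt
    refine ⟨WithLp.toLp 2 fun j => (x j - if j = i then t else 0) / (1 - t), ⟨?_, fun j => ?_⟩, ?_⟩
    · simp only [← Finset.sum_div, Finset.sum_sub_distrib, hx.1]
      simp [ht'.ne']
    · simp only
      refine div_pos ?_ ht'
      split_ifs with h
      · rw [h]; linarith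
      · simpa using hx.2 j
    · ext j
      rw [happ]
      simp only
      field_simp
      ring

theorem hausdorffMeasure_lt (i : Fin (n + 1)) {t : ℝ} (ht0 : 0 ≤ t) (ht : t < 1) :
    μH[(n : ℝ)].restrict (openSimplex n) {x | t < x i} =
      ENNReal.ofReal ((1 - t) ^ n) * μH[(n : ℝ)] (openSimplex n) := by
  rw [Measure.restrict_apply (isOpen_lt continuous_const (by fun_prop)).measurableSet,
    ← homothety_image i ht0 ht,
    hausdorffMeasure_homothety_image (by positivity) _ (by linarith : 1 - t ≠ 0)]
  rw [ENNReal.smul_def, smul_eq_mul, NNReal.rpow_natCast, ENNReal.coe_pow,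
    ENNReal.ofReal_pow (by linarith)]
  congr 2
  rw [← enorm_eq_nnnorm, Real.enorm_of_nonneg (by linarith)]

theorem integral_mul_one_sub_pow (n : ℕ) :
    ∫ t in (0 : ℝ)..1, (1 - t) ^ n * t = 1 / ((n + 1) * (n + 2)) := by
  have h := intervalIntegral.integral_comp_sub_left (a := 0) (b := 1)
    (fun u : ℝ => u ^ n * (1 - u)) 1
  simp only [sub_sub_cancel, sub_self, sub_zero] at h
  rw [h]
  have : ∀ u : ℝ, u ^ n * (1 - u) = u ^ n - u ^ (n + 1) := fun u => by ring
  simp only [this]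
  rw [intervalIntegral.integral_sub (by simp) (by simp), integral_pow, integral_pow]
  push_cast
  simp
  field_simp
  ring

theorem integrable_of_continuous (hfin : μH[(n : ℝ)] (openSimplex n) ≠ ∞)
    {F : EuclideanSpace ℝ (Fin (n + 1)) → ℝ} (hF : Continuous F) {C : ℝ}
    (hC : ∀ x ∈ openSimplex n, |F x| ≤ C) : IntegrableOn F (openSimplex n) μH[(n : ℝ)] :=
  IntegrableOn.of_bound hfin.lt_top hF.aestronglyMeasurable C
    ((ae_restrict_iff' measurableSet).2 (.of_forall hC))

theorem integrable_coord (hfin : μH[(n : ℝ)] (openSimplex n) ≠ ∞) (i : Fin (n + 1)) :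
    IntegrableOn (fun x => x i) (openSimplex n) μH[(n : ℝ)] :=
  integrable_of_continuous hfin (by fun_prop) (C := 1) fun x hx => by
    rw [abs_of_pos (hx.2 i)]; exact le_one hx i

theorem integrable_coord_mul (hfin : μH[(n : ℝ)] (openSimplex n) ≠ ∞) (i j : Fin (n + 1)) :
    IntegrableOn (fun x => x i * x j) (openSimplex n) μH[(n : ℝ)] :=
  integrable_of_continuous hfin (by fun_prop) (C := 1) fun x hx => by
    rw [abs_of_pos (mul_pos (hx.2 i) (hx.2 j))]
    exact mul_le_one₀ (le_one hx i) (hx.2 j).le (le_one hx j)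

theorem integral_coord_sq (i : Fin (n + 1)) :
    ∫ x in openSimplex n, x i * x i ∂μH[(n : ℝ)] =
      2 / ((n + 1) * (n + 2)) * μH[(n : ℝ)].real (openSimplex n) := by
  have hpos : ∀ᵐ x ∂(μH[(n : ℝ)].restrict (openSimplex n)), 0 ≤ x i :=
    (ae_restrict_iff' measurableSet).2 (.of_forall fun x hx => (hx.2 i).le)
  have hmeas : Measurable fun x : EuclideanSpace ℝ (Fin (n + 1)) => x i :=
    Continuous.measurable (by fun_prop)
  have hlc := lintegral_rpow_eq_lintegral_meas_lt_mul (μH[(n : ℝ)].restrict (openSimplex n))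
    hpos hmeas.aemeasurable (p := 2) (by norm_num)
  have hbeta : ∫⁻ t in Set.Ioi (0 : ℝ), μH[(n : ℝ)].restrict (openSimplex n)
      {x | t < x i} * ENNReal.ofReal (t ^ ((2 : ℝ) - 1)) =
        ENNReal.ofReal (1 / ((n + 1) * (n + 2))) * μH[(n : ℝ)] (openSimplex n) := by
    have hzero : ∀ t : ℝ, 1 ≤ t → μH[(n : ℝ)].restrict (openSimplex n) {x | t < x i} = 0 := by
      intro t ht
      rw [Measure.restrict_apply (isOpen_lt continuous_const (by fun_prop)).measurableSet]
      convert measure_empty (μ := μH[(n : ℝ)])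
      ext x
      simp only [Set.mem_inter_iff, Set.mem_ofPred_eq, Set.mem_empty_iff_false, iff_false, not_and]
      intro h1 hx
      linarith [le_one hx i]
    have hsplit : ∫⁻ t in Set.Ioi (0 : ℝ), μH[(n : ℝ)].restrict (openSimplex n)
        {x | t < x i} * ENNReal.ofReal (t ^ ((2 : ℝ) - 1)) =
        ∫⁻ t in Set.Ioc (0 : ℝ) 1,
          ENNReal.ofReal ((1 - t) ^ n * t) * μH[(n : ℝ)] (openSimplex n) := by
      rw [← lintegral_indicator measurableSet_Ioi, ← lintegral_indicator measurableSet_Ioc]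
      refine lintegral_congr_ae ?_
      filter_upwards [Measure.ae_ne volume (1 : ℝ)] with t ht1
      by_cases ht0 : 0 < t
      · rw [Set.indicator_of_mem (by exact ht0)]
        rcases lt_or_gt_of_ne ht1 with ht | ht
        · rw [Set.indicator_of_mem (show t ∈ Set.Ioc (0 : ℝ) 1 from ⟨ht0, ht.le⟩),
            hausdorffMeasure_lt i ht0.le ht,
            ENNReal.ofReal_mul (by have : 0 < 1 - t := by linarith
                                   positivity)]
          norm_num
          ring
        · rw [Set.indicator_of_notMem (fun h => absurd h.2 (not_le.2 ht)), hzero t ht.le, zero_mul]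
      · rw [Set.indicator_of_notMem (by exact ht0), Set.indicator_of_notMem (fun h => ht0 h.1)]
    rw [hsplit, lintegral_mul_const _ (by fun_prop), ← integral_mul_one_sub_pow,
      intervalIntegral.integral_of_le zero_le_one, ofReal_integral_eq_lintegral_ofReal]
    · exact (Continuous.integrableOn_Icc (by fun_prop)).mono_set Set.Ioc_subset_Icc_self
    · refine (ae_restrict_iff' measurableSet_Ioc).2 (.of_forall fun t ht => ?_)
      have h1 : 0 ≤ 1 - t := by linarith [ht.2]
      have h2 : 0 ≤ t := ht.1.le
      simp only [Pi.zero_apply]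
      positivity
  rw [hbeta] at hlc
  rw [integral_eq_lintegral_of_nonneg_ae (.of_forall fun x => mul_self_nonneg _)
    (hmeas.mul hmeas).aestronglyMeasurable]
  have : ∀ x : EuclideanSpace ℝ (Fin (n + 1)), x i * x i = x i ^ (2 : ℝ) := fun x => by
    rw [Real.rpow_two, sq]
  simp only [this, hlc]
  rw [ENNReal.toReal_mul, ENNReal.toReal_mul, ENNReal.toReal_ofReal (by norm_num),
    ENNReal.toReal_ofReal (by positivity), Measure.real]
  ring

theorem integral_comp_swap (i j : Fin (n + 1)) (F : EuclideanSpace ℝ (Fin (n + 1)) → ℝ) :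
    ∫ x in openSimplex n, F (WithLp.toLp 2 fun k => x (Equiv.swap i j k)) ∂μH[(n : ℝ)] =
      ∫ x in openSimplex n, F x ∂μH[(n : ℝ)] := by
  let e := (LinearIsometryEquiv.piLpCongrLeft 2 ℝ ℝ (Equiv.swap i j)).toIsometryEquiv
  have he : ∀ x, e x = WithLp.toLp 2 fun k => x (Equiv.swap i j k) := by
    intro x
    ext k
    simp [e, LinearIsometryEquiv.piLpCongrLeft_apply, Equiv.piCongrLeft'_apply]
  have hpre : e ⁻¹' openSimplex n = openSimplex n := by
    ext x
    simp only [Set.mem_preimage, he, openSimplex, Set.mem_ofPred_eq]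
    rw [Equiv.sum_comp (Equiv.swap i j) (fun k => x k)]
    exact and_congr_right fun _ => ((Equiv.swap i j).forall_congr_left
      (p := fun k => 0 < x (Equiv.swap i j k))).trans (by simp)
  have h := (e.measurePreserving_hausdorffMeasure (n : ℝ)).setIntegral_preimage_emb
    e.toHomeomorph.measurableEmbedding F (openSimplex n)
  rw [hpre] at h
  simpa only [he] using h

theorem integral_coord (hfin : μH[(n : ℝ)] (openSimplex n) ≠ ∞) (i : Fin (n + 1)) :
    ∫ x in openSimplex n, x i ∂μH[(n : ℝ)] = μH[(n : ℝ)].real (openSimplex n) / (n + 1) := by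
  have hsymm : ∀ j, ∫ x in openSimplex n, x j ∂μH[(n : ℝ)] =
      ∫ x in openSimplex n, x i ∂μH[(n : ℝ)] := by
    intro j
    have := integral_comp_swap i j (fun x => x i)
    simpa using this
  have hsum : ∑ j, ∫ x in openSimplex n, x j ∂μH[(n : ℝ)] = μH[(n : ℝ)].real (openSimplex n) := by
    rw [← integral_finsetSum _ fun j _ => integrable_coord hfin j,
      setIntegral_congr_fun measurableSet (g := fun _ => (1 : ℝ)) (fun x hx => hx.1)]
    simp
  simp only [hsymm, Finset.sum_const, Finset.card_univ, Fintype.card_fin, nsmul_eq_mul] at hsum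
  rw [← hsum]
  push_cast
  field_simp

theorem integral_coord_mul (hfin : μH[(n : ℝ)] (openSimplex n) ≠ ∞) {i j : Fin (n + 1)}
    (hij : i ≠ j) : ∫ x in openSimplex n, x i * x j ∂μH[(n : ℝ)] =
      1 / ((n + 1) * (n + 2)) * μH[(n : ℝ)].real (openSimplex n) := by
  have hn : (0 : ℝ) < n := by
    rcases Nat.eq_zero_or_pos n with rfl | hn
    · exact absurd (Subsingleton.elim (α := Fin 1) i j) hij
    · exact_mod_cast hn
  have hsymm : ∀ k ∈ Finset.univ.erase i, ∫ x in openSimplex n, x i * x k ∂μH[(n : ℝ)] =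
      ∫ x in openSimplex n, x i * x j ∂μH[(n : ℝ)] := by
    intro k hk
    have := integral_comp_swap k j (fun x => x i * x j)
    simpa [Equiv.swap_apply_of_ne_of_ne (Finset.ne_of_mem_erase hk).symm hij] using this
  have hsum : ∑ k, ∫ x in openSimplex n, x i * x k ∂μH[(n : ℝ)] =
      μH[(n : ℝ)].real (openSimplex n) / (n + 1) := by
    rw [← integral_finsetSum _ fun j _ => integrable_coord_mul hfin i j, ← integral_coord hfin i]
    refine setIntegral_congr_fun measurableSet fun x hx => ?_
    simp only [← Finset.mul_sum, hx.1, mul_one]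
  rw [← Finset.add_sum_erase _ _ (Finset.mem_univ i), Finset.sum_congr rfl hsymm,
    integral_coord_sq] at hsum
  simp only [Finset.sum_const, Finset.card_erase_of_mem (Finset.mem_univ i), Finset.card_univ,
    Fintype.card_fin, Nat.add_sub_cancel, nsmul_eq_mul] at hsum
  refine mul_left_cancel₀ hn.ne' ?_
  rw [eq_sub_of_add_eq' hsum]
  field_simp
  ring

theorem integral_linear (hfin : μH[(n : ℝ)] (openSimplex n) ≠ ∞) {a : Fin (n + 1) → ℝ}
    (ha : ∑ i, a i = 0) : ∫ x in openSimplex n, ∑ i, a i * x i ∂μH[(n : ℝ)] = 0 := by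
  rw [integral_finsetSum _ fun i _ => (integrable_coord hfin i).const_mul (a i)]
  simp only [integral_const_mul, integral_coord hfin]
  rw [← Finset.sum_mul, ha, zero_mul]

theorem integral_linear_sq (hfin : μH[(n : ℝ)] (openSimplex n) ≠ ∞) {a : Fin (n + 1) → ℝ}
    (ha : ∑ i, a i = 0) : ∫ x in openSimplex n, (∑ i, a i * x i) ^ 2 ∂μH[(n : ℝ)] =
      (∑ i, a i ^ 2) / ((n + 1) * (n + 2)) * μH[(n : ℝ)].real (openSimplex n) := by
  have hexp : ∀ x : EuclideanSpace ℝ (Fin (n + 1)),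
      (∑ i, a i * x i) ^ 2 = ∑ i, ∑ j, a i * a j * (x i * x j) := by
    intro x
    rw [sq, Finset.sum_mul_sum]
    refine Finset.sum_congr rfl fun i _ => Finset.sum_congr rfl fun j _ => by ring
  set c := 1 / (((n : ℝ) + 1) * (n + 2)) * μH[(n : ℝ)].real (openSimplex n) with hc
  have hval : ∀ i j, ∫ x in openSimplex n, x i * x j ∂μH[(n : ℝ)] =
      c + if i = j then c else 0 := by
    intro i j
    split_ifs with h
    · subst h
      rw [integral_coord_sq, hc]
      ring
    · rw [integral_coord_mul hfin h, add_zero]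
  simp only [hexp]
  rw [integral_finsetSum _ fun i _ => integrable_finsetSum _ fun j _ =>
    (integrable_coord_mul hfin i j).const_mul (a i * a j)]
  have : ∀ i, ∫ x in openSimplex n, ∑ j, a i * a j * (x i * x j) ∂μH[(n : ℝ)] = a i ^ 2 * c := by
    intro i
    rw [integral_finsetSum _ fun j _ => (integrable_coord_mul hfin i j).const_mul (a i * a j)]
    simp only [integral_const_mul, hval, mul_add, Finset.sum_add_distrib, mul_ite, mul_zero,
      Finset.sum_ite_eq, Finset.mem_univ, if_true]
    rw [← Finset.sum_mul, ← Finset.mul_sum, ha]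
    ring
  simp only [this]
  rw [← Finset.sum_mul, hc]
  ring

end openSimplex

theorem exists_linearIsometry_of_orthonormal_pair {m : ℕ} {a e : EuclideanSpace ℝ (Fin (m + 1 + 1))}
    (ha : ‖a‖ = 1) (he : e ≠ 0) (hae : inner ℝ a e = 0) :
    ∃ B : EuclideanSpace ℝ (Fin m) →ₗᵢ[ℝ] EuclideanSpace ℝ (Fin (m + 1 + 1)),
      (∀ z, inner ℝ a (B z) = 0 ∧ inner ℝ e (B z) = 0) ∧
      ∀ y, inner ℝ a y = 0 → inner ℝ e y = 0 → ∃ z, B z = y := by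
  have ha0 : a ≠ 0 := by rintro rfl; simp at ha
  let K : Submodule ℝ (EuclideanSpace ℝ (Fin (m + 1 + 1))) := Submodule.span ℝ (Set.range ![a, e])
  have hli : LinearIndependent ℝ ![a, e] := by
    refine linearIndependent_of_ne_zero_of_inner_eq_zero (𝕜 := ℝ) ?_ ?_
    · intro i; fin_cases i <;> simpa
    · intro i j hij
      fin_cases i <;> fin_cases j <;> simp_all [real_inner_comm]
  have hK : Module.finrank ℝ K = 2 := by
    rw [finrank_span_eq_card hli]; simp
  have hKo : Module.finrank ℝ Kᗮ = m := by
    have := K.finrank_add_finrank_orthogonal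
    rw [hK, finrank_euclideanSpace_fin] at this
    omega
  have hmem : ∀ y, y ∈ Kᗮ ↔ inner ℝ a y = 0 ∧ inner ℝ e y = 0 := by
    intro y
    rw [Submodule.mem_orthogonal]
    constructor
    · intro h
      exact ⟨h a (Submodule.subset_span ⟨0, rfl⟩), h e (Submodule.subset_span ⟨1, rfl⟩)⟩
    · rintro ⟨h1, h2⟩ x hx
      induction hx using Submodule.span_induction with
      | mem x hx =>
        obtain ⟨i, rfl⟩ := hx
        fin_cases i <;> simpa
      | zero => simp
      | add x y _ _ hx hy => rw [inner_add_left, hx, hy, add_zero]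
      | smul r x _ hx => rw [inner_smul_left, hx, mul_zero]
  let b := (stdOrthonormalBasis ℝ Kᗮ).reindex (finCongr hKo)
  let B := Kᗮ.subtypeₗᵢ.comp b.repr.symm.toLinearIsometry
  refine ⟨B, fun z => (hmem _).1 (b.repr.symm z).2, fun y h1 h2 => ?_⟩
  refine ⟨b.repr ⟨y, (hmem y).2 ⟨h1, h2⟩⟩, ?_⟩
  simp [B]

theorem ofReal_inv_le_div_of_le_mul {K : ℝ} (hK : 0 < K) {V S : ℝ≥0∞} (hV : V ≠ 0) (hV' : V ≠ ∞)
    (h : V ≤ ENNReal.ofReal K * S) : ENNReal.ofReal (1 / K) ≤ S / V := by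
  rw [ENNReal.le_div_iff_mul_le (Or.inl hV) (Or.inl hV'), one_div, ENNReal.ofReal_inv_of_pos hK,
    mul_comm, ← div_eq_mul_inv]
  exact ENNReal.div_le_of_le_mul' h

theorem central_section_constant_le (m : ℕ) :
    √(2 * Real.pi * Real.exp 1) * (1 / √(((m + 1 : ℕ) + 1) * ((m + 1 : ℕ) + 2))) *
      √(Real.exp 1 * (m + 1 : ℕ)) ≤ 2 * Real.exp 1 := by
  have he := Real.exp_pos 1
  have hd : (0 : ℝ) < ((m + 1 : ℕ) + 1) * ((m + 1 : ℕ) + 2) := by positivity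
  rw [mul_one_div, div_mul_eq_mul_div, ← Real.sqrt_mul (by positivity), ← Real.sqrt_div' _ hd.le,
    Real.sqrt_le_left (by positivity), div_le_iff₀ hd]
  have := Real.pi_le_four
  have hm : (0 : ℝ) ≤ m := m.cast_nonneg
  push_cast
  have h2 : 2 * Real.pi * (m + 1) ≤ 4 * ((m + 1 + 1) * (m + 1 + 2)) := by nlinarith
  nlinarith [mul_le_mul_of_nonneg_left h2 (sq_nonneg (Real.exp 1))]

/-- Isometric coordinates on the hyperplane of points whose coordinates sum to `1`, with origin the
barycenter and first axis in the direction `a`. -/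
theorem exists_isometry_sum_eq_one {m : ℕ} {a : EuclideanSpace ℝ (Fin (m + 1 + 1))} (ha : ‖a‖ = 1)
    (ha0 : ∑ i, a i = 0) :
    ∃ L : WithLp 2 (ℝ × EuclideanSpace ℝ (Fin m)) →ₗᵢ[ℝ] EuclideanSpace ℝ (Fin (m + 1 + 1)),
      (∀ w, ∑ i, a i * L w i = w.fst) ∧ (∀ w, ∑ i, L w i = 0) ∧
      ∀ y : EuclideanSpace ℝ (Fin (m + 1 + 1)), ∑ i, y i = 0 → ∃ w, L w = y := by
  let e : EuclideanSpace ℝ (Fin (m + 1 + 1)) := WithLp.toLp 2 fun _ => 1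
  have hinner : ∀ x y : EuclideanSpace ℝ (Fin (m + 1 + 1)), inner ℝ x y = ∑ i, x i * y i := by
    intro x y
    simp [PiLp.inner_apply, mul_comm]
  have hsum : ∀ y, inner ℝ e y = ∑ i, y i := fun y => by simp [hinner, e]
  have he : e ≠ 0 := fun h => by
    have := congrArg (fun x : EuclideanSpace ℝ (Fin (m + 1 + 1)) => x 0) h
    simp [e] at this
  obtain ⟨B, hB, hBs⟩ := exists_linearIsometry_of_orthonormal_pair ha he
    (by rw [real_inner_comm, hsum, ha0])
  let L : WithLp 2 (ℝ × EuclideanSpace ℝ (Fin m)) →ₗ[ℝ] EuclideanSpace ℝ (Fin (m + 1 + 1)) :=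
    { toFun := fun w => w.fst • a + B w.snd
      map_add' := fun x y => by simp only [WithLp.add_fst, WithLp.add_snd, map_add]; module
      map_smul' := fun r x => by
        simp only [WithLp.smul_fst, WithLp.smul_snd, map_smul, RingHom.id_apply, smul_eq_mul]
        module }
  have hL : ∀ w, L w = w.fst • a + B w.snd := fun _ => rfl
  refine ⟨⟨L, fun w => ?_⟩, fun w => ?_, fun w => ?_, fun y hy => ?_⟩
  · rw [WithLp.prod_norm_eq_of_L2, eq_comm, Real.sqrt_eq_iff_mul_self_eq (by positivity)
      (norm_nonneg _), hL, ← sq, norm_add_sq_real, inner_smul_left, (hB _).1, norm_smul, ha,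
      LinearIsometry.norm_map]
    ring
  · change ∑ i, a i * L w i = _
    rw [← hinner, hL, inner_add_right, inner_smul_right, (hB _).1, real_inner_self_eq_norm_sq, ha]
    ring
  · change ∑ i, L w i = _
    rw [← hsum, hL, inner_add_right, inner_smul_right, (hB _).2, hsum, ha0]
    ring
  · obtain ⟨z, hz⟩ := hBs (y - inner ℝ a y • a)
      (by rw [inner_sub_right, inner_smul_right, real_inner_self_eq_norm_sq, ha]; ring)
      (by rw [inner_sub_right, inner_smul_right, hsum, hsum, ha0, hy]; ring)
    exact ⟨WithLp.toLp 2 (inner ℝ a y, z), by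
      change _ • a + B z = y
      rw [hz]; simp⟩

theorem openSimplex.hausdorffMeasure_le_mul_section {m : ℕ}
    {a : EuclideanSpace ℝ (Fin (m + 1 + 1))} (ha : ‖a‖ = 1) (ha0 : ∑ i, a i = 0) :
    μH[((m + 1 : ℕ) : ℝ)] (openSimplex (m + 1)) ≠ 0 ∧
    μH[((m + 1 : ℕ) : ℝ)] (openSimplex (m + 1)) ≠ ∞ ∧
    μH[((m + 1 : ℕ) : ℝ)] (openSimplex (m + 1)) ≤
      ENNReal.ofReal (2 * Real.exp 1) *
        μH[(m : ℝ)] (openSimplex (m + 1) ∩ {x | ∑ i, a i * x i = 0}) := by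
  obtain ⟨L, hLa, hLs, hLsurj⟩ := exists_isometry_sum_eq_one ha ha0
  let c : EuclideanSpace ℝ (Fin (m + 1 + 1)) := WithLp.toLp 2 fun _ => 1 / ((m : ℝ) + 1 + 1)
  have hcs : ∑ i, c i = 1 := by
    simp [c]
    field_simp
  have hca : ∑ i, a i * c i = 0 := by
    simp only [c]
    rw [← Finset.sum_mul, ha0, zero_mul]
  let J : WithLp 2 (ℝ × EuclideanSpace ℝ (Fin m)) → EuclideanSpace ℝ (Fin (m + 1 + 1)) :=
    fun w => c + L w
  have hJ : Isometry J := Isometry.of_dist_eq fun x y => by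
    simp only [J, dist_add_left, L.dist_map]
  have hJa : ∀ w, ∑ i, a i * J w i = w.fst := fun w => by
    simp only [J, PiLp.add_apply, mul_add, Finset.sum_add_distrib, hca, hLa, zero_add]
  have hJs : ∀ w, ∑ i, J w i = 1 := fun w => by
    simp only [J, PiLp.add_apply, Finset.sum_add_distrib, hcs, hLs, add_zero]
  have hJsurj : openSimplex (m + 1) ⊆ Set.range J := fun x hx => by
    obtain ⟨w, hw⟩ := hLsurj (x - c) (by
      simp only [PiLp.sub_apply, Finset.sum_sub_distrib, hcs, hx.1, sub_self])
    exact ⟨w, by simp only [J, hw, add_sub_cancel]⟩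
  let D : Set (ℝ × EuclideanSpace ℝ (Fin m)) := {q | ∀ i, 0 < J (WithLp.toLp 2 q) i}
  have hpre : J ⁻¹' openSimplex (m + 1) = WithLp.ofLp ⁻¹' D := by
    ext w
    simp [openSimplex, hJs, D]
  have himg : J '' (WithLp.ofLp ⁻¹' D) = openSimplex (m + 1) := by
    rw [← hpre, Set.image_preimage_eq_of_subset hJsurj]
  have hDo : IsOpen D := by
    have : D = ⋂ i, {q | 0 < J (WithLp.toLp 2 q) i} := by ext; simp [D]
    rw [this]
    refine isOpen_iInter_of_finite fun i => isOpen_lt continuous_const ?_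
    have := hJ.continuous
    fun_prop
  have hD : Convex ℝ D := by
    intro x hx y hy s t hs ht hst i
    have : J (WithLp.toLp 2 (s • x + t • y)) i =
        s * J (WithLp.toLp 2 x) i + t * J (WithLp.toLp 2 y) i := by
      simp only [J, WithLp.toLp_add, WithLp.toLp_smul, map_add, map_smul, PiLp.add_apply,
        PiLp.smul_apply, smul_eq_mul]
      linear_combination (-c i) * hst
    rw [this]
    rcases hs.eq_or_lt with rfl | hs
    · rw [zero_add] at hst
      simpa [hst] using hy i
    · exact add_pos_of_pos_of_nonneg (mul_pos hs (hx i)) (mul_nonneg ht (hy i).le)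
  have hDb : Bornology.IsBounded D := by
    have h := (WithLp.prod_lipschitzWith_ofLp 2 ℝ (EuclideanSpace ℝ (Fin m))).isBounded_image
      (hJ.antilipschitz.isBounded_preimage (isBounded (n := m + 1)))
    rwa [hpre, Set.image_preimage_eq _ (WithLp.ofLp_surjective 2)] at h
  have h0 : ((0, 0) : ℝ × EuclideanSpace ℝ (Fin m)) ∈ D := by
    intro i
    have : (WithLp.toLp 2 ((0, 0) : ℝ × EuclideanSpace ℝ (Fin m))) = 0 := rfl
    simp only [J, this, map_zero, add_zero, c]
    positivity
  have hmeasD : μH[((m + 1 : ℕ) : ℝ)] (WithLp.ofLp ⁻¹' D : Set (WithLp 2 (ℝ × _))) =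
      μH[((m + 1 : ℕ) : ℝ)] (openSimplex (m + 1)) := by
    rw [← himg, hJ.hausdorffMeasure_image (Or.inl (by positivity))]
  have hne : μH[((m + 1 : ℕ) : ℝ)] (openSimplex (m + 1)) ≠ 0 ∧
      μH[((m + 1 : ℕ) : ℝ)] (openSimplex (m + 1)) ≠ ∞ := by
    obtain ⟨k, -, hk, hk0, -, -, h, -⟩ := exists_hausdorffMeasure_eq_smul_volume m
    rw [← hmeasD, h D hDo.measurableSet]
    exact ⟨mul_ne_zero hk0 (hDo.measure_pos volume ⟨_, h0⟩).ne',
      ENNReal.mul_ne_top hk hDb.measure_lt_top.ne⟩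
  refine ⟨hne.1, hne.2, ?_⟩
  have htransfer : ∀ f : ℝ → ℝ,
      ∫ w in (WithLp.ofLp ⁻¹' D : Set (WithLp 2 (ℝ × EuclideanSpace ℝ (Fin m)))), f w.fst
        ∂μH[((m + 1 : ℕ) : ℝ)] =
      ∫ x in openSimplex (m + 1), f (∑ i, a i * x i) ∂μH[((m + 1 : ℕ) : ℝ)] := by
    intro f
    have h := hJ.isClosedEmbedding.measurableEmbedding.setIntegral_map
      (μ := μH[((m + 1 : ℕ) : ℝ)]) (fun x => f (∑ i, a i * x i)) (openSimplex (m + 1))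
    rw [hJ.map_hausdorffMeasure (Or.inl (by positivity)),
      Measure.restrict_restrict measurableSet, Set.inter_eq_left.2 hJsurj, hpre] at h
    simpa only [hJa] using h.symm
  have hsq : ∑ i, a i ^ 2 = 1 := by
    rw [← EuclideanSpace.real_norm_sq_eq, ha, one_pow]
  have hsection : μH[(m : ℝ)] (Prod.mk 0 ⁻¹' D) =
      μH[(m : ℝ)] (openSimplex (m + 1) ∩ {x | ∑ i, a i * x i = 0}) := by
    let ι : EuclideanSpace ℝ (Fin m) → EuclideanSpace ℝ (Fin (m + 1 + 1)) :=
      fun z => J (WithLp.toLp 2 (0, z))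
    have hι : Isometry ι := hJ.comp (Isometry.of_dist_eq fun x y => by
      simp)
    rw [← hι.hausdorffMeasure_image (Or.inl (by positivity))]
    congr 1
    ext x
    constructor
    · rintro ⟨z, hz, rfl⟩
      exact ⟨⟨hJs _, hz⟩, hJa _⟩
    · rintro ⟨hx, hxa⟩
      obtain ⟨w, rfl⟩ := hJsurj hx
      rw [Set.mem_ofPred_eq, hJa] at hxa
      have hw : w = WithLp.toLp 2 (0, w.snd) := by
        rw [← hxa]; rfl
      rw [hw] at hx ⊢
      exact ⟨w.snd, hx.2, rfl⟩
  refine (hmeasD.symm.trans_le (hausdorffMeasure_le_mul_central_section hD hDo hDb h0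
    (σ := 1 / √(((m + 1 : ℕ) + 1) * ((m + 1 : ℕ) + 2))) (by positivity) ?_ ?_)).trans ?_
  · rw [htransfer fun s => s]
    exact integral_linear hne.2 ha0
  · rw [htransfer fun s => s ^ 2, integral_linear_sq hne.2 ha0, hsq, Measure.real, Measure.real,
      hmeasD, div_pow, one_pow, Real.sq_sqrt (by positivity)]
  · rw [hsection]
    exact mul_le_mul_left (ENNReal.ofReal_le_ofReal (central_section_constant_le m)) _

/-- Lemma 4.1, part 2. If an affine hyperplane `H` of
`A = {x : Σ x_i = 1}` passes through the center `c = (1/d, …, 1/d)` of the standard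
simplex `Δ`, then the `(d−2)`-dimensional volume of the central section `Δ ∩ H` is at
least `1/(2e)` times the `(d−1)`-dimensional volume of `Δ`. -/
theorem simplex_central_section_volume
    (d : ℕ)
    (A : Set (EuclideanSpace ℝ (Fin d))) (hA : A = {x | ∑ i, x i = 1})
    (Δ : Set (EuclideanSpace ℝ (Fin d)))
    (hΔ : Δ = {x | (∑ i, x i = 1) ∧ ∀ i, 0 < x i})
    (u : EuclideanSpace ℝ (Fin d)) (t : ℝ)
    (hu : ¬ ∃ s : ℝ, ∀ i, u i = s)
    (hc : ∑ i, u i * ((1 : ℝ) / d) = t)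
    (H : Set (EuclideanSpace ℝ (Fin d))) (hH : H = {x ∈ A | ∑ i, u i * x i = t}) :
    μH[(d : ℝ) - 2] (Δ ∩ H) / μH[(d : ℝ) - 1] Δ ≥
      ENNReal.ofReal (1 / (2 * Real.exp 1)) := by
  match d with
  | 0 => exact absurd ⟨0, fun i => i.elim0⟩ hu
  | 1 => exact absurd ⟨u 0, fun i => by rw [Subsingleton.elim i 0]⟩ hu
  | m + 2 =>
    let v : EuclideanSpace ℝ (Fin (m + 1 + 1)) := WithLp.toLp 2 fun i => u i - t
    have hv : ‖v‖ ≠ 0 := fun h => hu ⟨t, fun i => by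
      have := congrArg (fun x : EuclideanSpace ℝ (Fin (m + 1 + 1)) => x i) (norm_eq_zero.1 h)
      simpa [v, sub_eq_zero] using this⟩
    have hvs : ∑ i, v i = 0 := by
      simp only [v, Finset.sum_sub_distrib, Finset.sum_const, Finset.card_univ, Fintype.card_fin,
        nsmul_eq_mul, ← hc, ← Finset.sum_mul]
      push_cast
      field_simp
      ring
    let a := ‖v‖⁻¹ • v
    have hcoord : ∀ i, a i = ‖v‖⁻¹ * (u i - t) := fun i => by simp [a, v]
    have ha : ‖a‖ = 1 := norm_smul_inv_norm (𝕜 := ℝ) (norm_ne_zero_iff.1 hv)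
    have ha0 : ∑ i, a i = 0 := by
      simp only [a, PiLp.smul_apply, smul_eq_mul, ← Finset.mul_sum, hvs, mul_zero]
    obtain ⟨hV, hV', hle⟩ := openSimplex.hausdorffMeasure_le_mul_section ha ha0
    have hΔ' : Δ = openSimplex (m + 1) := hΔ
    have hsec : Δ ∩ H = openSimplex (m + 1) ∩ {x | ∑ i, a i * x i = 0} := by
      rw [hΔ', hH, hA]
      ext x
      simp only [Set.mem_inter_iff, Set.mem_ofPred_eq]
      refine and_congr_right fun hx => ?_
      have : ∑ i, a i * x i = ‖v‖⁻¹ * (∑ i, u i * x i - t) := by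
        simp only [hcoord, mul_assoc, ← Finset.mul_sum, sub_mul, Finset.sum_sub_distrib]
        rw [hx.1, mul_one]
      rw [this, mul_eq_zero, or_iff_right (inv_ne_zero hv), sub_eq_zero]
      exact and_iff_right hx.1
    have hd : ((m + 2 : ℕ) : ℝ) - 2 = m := by push_cast; ring
    have hd' : ((m + 2 : ℕ) : ℝ) - 1 = (m + 1 : ℕ) := by push_cast; ring
    rw [hd, hd', hsec, hΔ', ge_iff_le]
    exact ofReal_inv_le_div_of_le_mul (by positivity) hV hV' hle
end

section
/- Let Δ ⊂ R^d be the standard open simplex {x : x_1 + … + x_d = 1, x_i > 0 for all i} and fix a = (α_1, …, α_d) ∈ Δ. Define the projective transformation T_a : Δ → Δ by T_a(x) = y with y_i = α_i x_i / (α_1 x_1 + … + α_d x_d). For x ∈ Δ, the derivative DT_a(x) maps the hyperplane H = {x : x_1 + … + x_d = 0} to itself, and its Jacobian satisfies |DT_a(x)| = (α_1 ⋯ α_d) / (α_1 x_1 + … + α_d x_d)^d. -/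
/-- An endomorphism preserving a subspace and acting as the identity modulo it has the same
determinant as its restriction. -/
theorem LinearMap.det_restrict_eq_det_of_sub_mem {K V : Type*} [Field K] [AddCommGroup V]
    [Module K V] [FiniteDimensional K V] (W : Submodule K V) (e : V →ₗ[K] V)
    (he : ∀ v ∈ W, e v ∈ W) (h : ∀ v, e v - v ∈ W) :
    LinearMap.det (e.restrict he) = LinearMap.det e := by
  have hQ : W.mapQ W e he = LinearMap.id := by
    refine LinearMap.ext fun q ↦ ?_
    obtain ⟨v, rfl⟩ := W.mkQ_surjective q
    exact (Submodule.Quotient.eq W).2 (h v)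
  rw [LinearMap.det_eq_det_mul_det W e he, hQ, LinearMap.det_id, mul_one]

/-- The determinant, on the hyperplane `σ = 0`, of the derivative at `x` of the map
`y ↦ (φ y)⁻¹ • A y`, where `φ = σ ∘ A` and `σ x = 1`. -/
theorem LinearMap.det_restrict_projective_derivative {K V : Type*} [Field K] [AddCommGroup V]
    [Module K V] [FiniteDimensional K V] (A D : V →ₗ[K] V) (σ φ : Module.Dual K V) (x : V)
    (W : Submodule K V) (hW : ∀ v, v ∈ W ↔ σ v = 0) (hφ : ∀ v, σ (A v) = φ v)
    (hσ : σ x = 1) (hx : φ x ≠ 0)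
    (hD : ∀ v, D v = (φ x)⁻¹ • A v - ((φ x)⁻¹ ^ 2 * φ v) • A x) (hDW : ∀ v ∈ W, D v ∈ W) :
    LinearMap.det (D.restrict hDW) = (φ x)⁻¹ ^ Module.finrank K V * LinearMap.det A := by
  set f : Module.Dual K V := σ - (φ x)⁻¹ • φ with hf
  have hfx : f x = 0 := by simp [hf, hσ, hx]
  set M : V →ₗ[K] V := ((φ x)⁻¹ • A) ∘ₗ LinearMap.transvection f x with hM
  have hMv (v : V) : M v = D v + ((φ x)⁻¹ * σ v) • A x := by
    simp only [hM, hf, hD, LinearMap.comp_apply, LinearMap.transvection.apply, map_add, map_smul,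
      LinearMap.smul_apply, LinearMap.sub_apply, smul_eq_mul]
    module
  have hMD (v : V) (hv : v ∈ W) : M v = D v := by simp [hMv, (hW v).1 hv]
  have hMW : ∀ v ∈ W, M v ∈ W := fun v hv ↦ hMD v hv ▸ hDW v hv
  have hres : D.restrict hDW = M.restrict hMW :=
    LinearMap.ext fun v ↦ Subtype.ext (hMD v v.2).symm
  rw [hres, LinearMap.det_restrict_eq_det_of_sub_mem, hM, LinearMap.det_comp, LinearMap.det_smul,
    ← LinearEquiv.transvection.coe_toLinearMap hfx, ← LinearEquiv.coe_det,
    LinearEquiv.transvection.det_eq_one, Units.val_one, mul_one]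
  intro v
  simp only [hW, hMv, hD, map_sub, map_add, map_smul, hφ, smul_eq_mul]
  field_simp
  ring

/-- Lemma 4.2. The projective transformation
`T_a(x)_i = α_i x_i / Σ_j α_j x_j` of the open standard simplex has, at every point `x`
of the simplex, a derivative that maps the hyperplane `H = {v : Σ v_i = 0}` to itself,
and the absolute value of the determinant of its restriction to `H` (the Jacobian) is
`(α_1 ⋯ α_d) / (α_1 x_1 + … + α_d x_d)^d`. -/
theorem projective_transformation_jacobian
    (d : ℕ) (a : EuclideanSpace ℝ (Fin d))
    (ha : (∑ i, a i = 1) ∧ ∀ i, 0 < a i)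
    (T : EuclideanSpace ℝ (Fin d) → EuclideanSpace ℝ (Fin d))
    (hT : ∀ x i, T x i = a i * x i / ∑ j, a j * x j)
    (x : EuclideanSpace ℝ (Fin d))
    (hx : (∑ i, x i = 1) ∧ ∀ i, 0 < x i)
    (Hsub : Submodule ℝ (EuclideanSpace ℝ (Fin d)))
    (hHsub : (Hsub : Set (EuclideanSpace ℝ (Fin d))) = {v | ∑ i, v i = 0}) :
    ∃ (D : EuclideanSpace ℝ (Fin d) →L[ℝ] EuclideanSpace ℝ (Fin d))
      (hD : ∀ v ∈ Hsub, D v ∈ Hsub),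
      HasFDerivAt T D x ∧
      |LinearMap.det (LinearMap.restrict
          (D : EuclideanSpace ℝ (Fin d) →ₗ[ℝ] EuclideanSpace ℝ (Fin d)) hD)| =
        (∏ i, a i) / (∑ i, a i * x i) ^ d := by
  set A : EuclideanSpace ℝ (Fin d) →L[ℝ] EuclideanSpace ℝ (Fin d) :=
    LinearMap.toContinuousLinearMap (Matrix.toLpLin 2 2 (Matrix.diagonal fun i ↦ a i)) with hA
  set φ : EuclideanSpace ℝ (Fin d) →L[ℝ] ℝ := ∑ i, a i • EuclideanSpace.proj i with hφ
  set σ : EuclideanSpace ℝ (Fin d) →L[ℝ] ℝ := ∑ i, EuclideanSpace.proj i with hσ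
  have hAv (v : EuclideanSpace ℝ (Fin d)) (i : Fin d) : A v i = a i * v i := by
    simp [hA, Matrix.toLpLin_apply, Matrix.mulVec_diagonal]
  have hφv (v : EuclideanSpace ℝ (Fin d)) : φ v = ∑ i, a i * v i := by simp [hφ]
  have hσv (v : EuclideanSpace ℝ (Fin d)) : σ v = ∑ i, v i := by simp [hσ]
  have hσA (v : EuclideanSpace ℝ (Fin d)) : σ (A v) = φ v := by simp [hσv, hφv, hAv]
  have hW (v : EuclideanSpace ℝ (Fin d)) : v ∈ Hsub ↔ σ v = 0 := by
    rw [← SetLike.mem_coe, hHsub, hσv, Set.mem_ofPred_eq]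
  have hne : (Finset.univ : Finset (Fin d)).Nonempty :=
    Finset.nonempty_of_sum_ne_zero (hx.1.trans_ne one_ne_zero)
  have hpos : 0 < φ x := by
    rw [hφv]
    exact Finset.sum_pos (fun i _ ↦ mul_pos (ha.2 i) (hx.2 i)) hne
  have hTA : T = fun y ↦ (φ y)⁻¹ • A y := by
    ext y i
    simp [hT, hφv, hAv, div_eq_inv_mul]
  set D : EuclideanSpace ℝ (Fin d) →L[ℝ] EuclideanSpace ℝ (Fin d) :=
    (φ x)⁻¹ • A + (-((φ x)⁻¹ ^ 2) • φ).smulRight (A x) with hD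
  have hDv (v : EuclideanSpace ℝ (Fin d)) :
      D v = (φ x)⁻¹ • A v - ((φ x)⁻¹ ^ 2 * φ v) • A x := by
    simp [hD, sub_eq_add_neg]
  have hDW : ∀ v ∈ Hsub, D v ∈ Hsub := by
    intro v _
    simp only [hW, hDv, map_sub, map_smul, hσA, smul_eq_mul]
    field_simp
    ring
  refine ⟨D, hDW, ?_, ?_⟩
  · have hinv := (hasDerivAt_inv hpos.ne').comp_hasFDerivAt x φ.hasFDerivAt
    rw [hTA]
    refine HasFDerivAt.congr_fderiv (hinv.smul A.hasFDerivAt) ?_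
    ext v i
    simp [hD]
  · have hdet : LinearMap.det (A : EuclideanSpace ℝ (Fin d) →ₗ[ℝ] EuclideanSpace ℝ (Fin d)) =
        ∏ i, a i := by
      rw [hA, LinearMap.coe_toContinuousLinearMap, Matrix.toLpLin_eq_toLin,
        LinearMap.det_toLin, Matrix.det_diagonal]
    have key := LinearMap.det_restrict_projective_derivative (A : _ →ₗ[ℝ] _) (D : _ →ₗ[ℝ] _)
      (σ : _ →ₗ[ℝ] ℝ) (φ : _ →ₗ[ℝ] ℝ) x Hsub hW hσA ((hσv x).trans hx.1) hpos.ne' hDv hDW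
    rw [key, hdet, ← hφv, finrank_euclideanSpace_fin, ContinuousLinearMap.coe_coe, inv_pow,
      inv_mul_eq_div, abs_of_nonneg]
    exact div_nonneg (Finset.prod_nonneg fun i _ ↦ (ha.2 i).le) (pow_nonneg hpos.le d)
end

section
/- Let m, n > 1 and let R = (r_1, …, r_m), C = (c_1, …, c_n) be positive integer vectors with Σ_i r_i = Σ_j c_j = N. For a positive integer k, define the cloned margins R_k = (k r_1 repeated k times, …, k r_m repeated k times) and C_k = (k c_1 repeated k times, …, k c_n repeated k times), which are a km-vector and a kn-vector with common total sum k²N. Then ρ(R_k, C_k) = ρ(R, C)^{k²}, where ρ is the minimum over the open cube of the function F associated to the respective margins. -/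
/-- The index of the `a`-th copy of the entry `i` in a vector whose entries are repeated `k`
times. -/
def cloneEquiv (m k : ℕ) : Fin m × Fin k ≃ Fin (k * m) :=
  finProdFinEquiv.trans (finCongr (mul_comm m k))

theorem cloneEquiv_div {m k : ℕ} (i : Fin m) (a : Fin k)
    (h : (cloneEquiv m k (i, a)).val / k < m) :
    (⟨(cloneEquiv m k (i, a)).val / k, h⟩ : Fin m) = i := by
  have hk : 0 < k := a.pos
  ext
  simp [cloneEquiv, Nat.add_mul_div_left _ _ hk, Nat.div_eq_of_lt a.isLt]

theorem prod_clone {m k : ℕ} (f : Fin (k * m) → ℝ) :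
    ∏ i, f i = ∏ a : Fin k, ∏ i : Fin m, f (cloneEquiv m k (i, a)) := by
  rw [← (cloneEquiv m k).prod_comp, Fintype.prod_prod_type_right]

theorem prod_zpow_clone {m k : ℕ} (r : Fin m → ℕ) (x : Fin (k * m) → ℝ) :
    (∏ i, x i ^ (-((k * r ⟨i.val / k, Nat.div_lt_of_lt_mul i.isLt⟩ : ℕ) : ℤ))) =
      ∏ a : Fin k, (∏ i : Fin m, x (cloneEquiv m k (i, a)) ^ (-(r i : ℤ))) ^ k := by
  rw [prod_clone]
  refine Finset.prod_congr rfl fun a _ => ?_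
  rw [← Finset.prod_pow]
  refine Finset.prod_congr rfl fun i _ => ?_
  rw [cloneEquiv_div, ← zpow_natCast, ← zpow_mul]
  congr 1
  push_cast
  ring

/-- The function `F` of the cloned margins is the product of the values of the original function
over all pairs of a copy of the rows and a copy of the columns. -/
theorem cloned_function_eq_prod {m n k : ℕ} (r : Fin m → ℕ) (c : Fin n → ℕ)
    (x : Fin (k * m) → ℝ) (y : Fin (k * n) → ℝ) :
    (∏ i, x i ^ (-((k * r ⟨i.val / k, Nat.div_lt_of_lt_mul i.isLt⟩ : ℕ) : ℤ))) *
        (∏ j, y j ^ (-((k * c ⟨j.val / k, Nat.div_lt_of_lt_mul j.isLt⟩ : ℕ) : ℤ))) *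
        (∏ i, ∏ j, (1 - x i * y j)⁻¹) =
      ∏ a : Fin k, ∏ b : Fin k,
        ((∏ i, x (cloneEquiv m k (i, a)) ^ (-(r i : ℤ))) *
          (∏ j, y (cloneEquiv n k (j, b)) ^ (-(c j : ℤ))) *
          (∏ i, ∏ j, (1 - x (cloneEquiv m k (i, a)) * y (cloneEquiv n k (j, b)))⁻¹)) := by
  simp only [Finset.prod_mul_distrib]
  congr 1
  · rw [prod_zpow_clone, prod_zpow_clone]
    simp [Finset.prod_pow]
  · rw [prod_clone]
    refine Finset.prod_congr rfl fun a _ => ?_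
    rw [Finset.prod_comm, prod_clone]
    exact Finset.prod_congr rfl fun b _ => Finset.prod_comm


/-- For the cloned margins `R_k` (each entry `k r_i` repeated `k`
times) and `C_k` (each entry `k c_j` repeated `k` times), the minimum `ρ(R_k, C_k)` of
the associated function `F` over the open cube equals `ρ(R, C)^{k²}`. -/
theorem rho_of_cloned_margins
    (m n N k : ℕ) (hm : 1 < m) (hn : 1 < n) (hk : 0 < k)
    (r : Fin m → ℕ) (c : Fin n → ℕ)
    (hr : ∀ i, 0 < r i) (hc : ∀ j, 0 < c j)
    (hrN : ∑ i, r i = N) (hcN : ∑ j, c j = N)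
    (ρ : ℝ)
    (hρ : IsLeast {z : ℝ | ∃ (x : Fin m → ℝ) (y : Fin n → ℝ),
      (∀ i, x i ∈ Set.Ioo (0 : ℝ) 1) ∧ (∀ j, y j ∈ Set.Ioo (0 : ℝ) 1) ∧
      (∏ i, x i ^ (-(r i : ℤ))) * (∏ j, y j ^ (-(c j : ℤ))) *
        (∏ i, ∏ j, (1 - x i * y j)⁻¹) = z} ρ)
    (ρk : ℝ)
    (hρk : IsLeast {z : ℝ | ∃ (x : Fin (k * m) → ℝ) (y : Fin (k * n) → ℝ),
      (∀ i, x i ∈ Set.Ioo (0 : ℝ) 1) ∧ (∀ j, y j ∈ Set.Ioo (0 : ℝ) 1) ∧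
      (∏ i, x i ^ (-((k * r ⟨i.val / k, Nat.div_lt_of_lt_mul i.isLt⟩ : ℕ) : ℤ))) *
        (∏ j, y j ^ (-((k * c ⟨j.val / k, Nat.div_lt_of_lt_mul j.isLt⟩ : ℕ) : ℤ))) *
        (∏ i, ∏ j, (1 - x i * y j)⁻¹) = z} ρk) :
    ρk = ρ ^ (k ^ 2) := by
  have hpos : 0 ≤ ρ := by
    obtain ⟨x, y, hx, hy, rfl⟩ := hρ.1
    refine mul_nonneg (mul_nonneg ?_ ?_) ?_
    · exact Finset.prod_nonneg fun i _ => zpow_nonneg (hx i).1.le _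
    · exact Finset.prod_nonneg fun j _ => zpow_nonneg (hy j).1.le _
    · refine Finset.prod_nonneg fun i _ => Finset.prod_nonneg fun j _ => inv_nonneg.2 ?_
      exact sub_nonneg.2 (mul_le_one₀ (hx i).2.le (hy j).1.le (hy j).2.le)
  have hconst : ρ ^ (k ^ 2) = ∏ _a : Fin k, ∏ _b : Fin k, ρ := by
    simp [← pow_mul, sq]
  apply le_antisymm
  · obtain ⟨x, y, hx, hy, hxy⟩ := hρ.1
    refine hρk.2 ⟨fun i => x ((cloneEquiv m k).symm i).1, fun j => y ((cloneEquiv n k).symm j).1,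
      fun i => hx _, fun j => hy _, ?_⟩
    rw [cloned_function_eq_prod, hconst]
    simp only [Equiv.symm_apply_apply, hxy]
  · obtain ⟨x, y, hx, hy, hxy⟩ := hρk.1
    rw [← hxy, cloned_function_eq_prod, hconst]
    refine Finset.prod_le_prod (fun a _ => Finset.prod_nonneg fun b _ => hpos) fun a _ =>
      Finset.prod_le_prod (fun b _ => hpos) fun b _ => ?_
    exact hρ.2 ⟨fun i => x (cloneEquiv m k (i, a)), fun j => y (cloneEquiv n k (j, b)),
      fun i => hx _, fun j => hy _, rfl⟩
end

section
/- Let m, n > 1 and let R = (r_1, …, r_m), C = (c_1, …, c_n) be positive integer vectors with Σ_i r_i = Σ_j c_j = N, and for each positive integer k let (R_k, C_k) be the cloned margins. Then lim_{k → ∞} (1/k²) ln #(R_k, C_k) = ln ρ(R, C), where #(R_k, C_k) is the number of km × kn nonnegative integer matrices with row sums R_k and column sums C_k. -/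
open Filter

/-- The number of nonnegative integer matrices with row sums `a` and column sums `b`. -/
noncomputable def marginCount {I J : Type*} [Fintype I] [Fintype J] (a : I → ℕ) (b : J → ℕ) : ℕ :=
  Nat.card {D : I → J → ℕ // (∀ i, ∑ j, D i j = a i) ∧ ∀ j, ∑ i, D i j = b j}

section Counting

variable {I J I' J' : Type*} [Fintype I] [Fintype J] [Fintype I'] [Fintype J']

lemma finite_matrices_with_margins (a : I → ℕ) (b : J → ℕ) :
    {D : I → J → ℕ | (∀ i, ∑ j, D i j = a i) ∧ ∀ j, ∑ i, D i j = b j}.Finite := by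
  classical
  refine (Set.finite_Icc (0 : I → J → ℕ) fun i _ => a i).subset ?_
  rintro D ⟨hD, -⟩
  refine ⟨fun i j => Nat.zero_le _, fun i j => ?_⟩
  show D i j ≤ a i
  rw [← hD i]
  exact Finset.single_le_sum (f := D i) (fun _ _ => Nat.zero_le _) (Finset.mem_univ j)

instance finite_matrices_with_margins_subtype (a : I → ℕ) (b : J → ℕ) :
    Finite {D : I → J → ℕ // (∀ i, ∑ j, D i j = a i) ∧ ∀ j, ∑ i, D i j = b j} :=
  (finite_matrices_with_margins a b).to_subtype

lemma exists_matrix_with_margins (a : I → ℕ) (b : J → ℕ) (h : ∑ i, a i = ∑ j, b j) :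
    ∃ D : I → J → ℕ, (∀ i, ∑ j, D i j = a i) ∧ ∀ j, ∑ i, D i j = b j := by
  classical
  induction hs : ∑ i, a i generalizing a b with
  | zero =>
    rw [hs] at h
    have ha : ∀ i, a i = 0 := by simpa using hs
    have hb : ∀ j, b j = 0 := by simpa using h.symm
    exact ⟨0, by simp [ha], by simp [hb]⟩
  | succ s ih =>
    obtain ⟨i, -, hi⟩ : ∃ i ∈ Finset.univ, a i ≠ 0 :=
      Finset.exists_ne_zero_of_sum_ne_zero (by omega)
    obtain ⟨j, -, hj⟩ : ∃ j ∈ Finset.univ, b j ≠ 0 :=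
      Finset.exists_ne_zero_of_sum_ne_zero (by omega)
    have ea : a = (a - Pi.single i 1) + Pi.single i 1 := by
      funext x
      by_cases hx : x = i
      · subst hx; simp; omega
      · simp [hx]
    have eb : b = (b - Pi.single j 1) + Pi.single j 1 := by
      funext x
      by_cases hx : x = j
      · subst hx; simp; omega
      · simp [hx]
    generalize a - Pi.single i 1 = a' at ea
    generalize b - Pi.single j 1 = b' at eb
    subst ea eb
    simp only [Pi.add_apply, Finset.sum_add_distrib, Finset.sum_pi_single', Finset.mem_univ,
      if_true] at h hs
    obtain ⟨D, hD₁, hD₂⟩ := ih a' b' (by omega) (by omega)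
    refine ⟨fun x y => D x y + Pi.single (M := fun _ => ℕ) i 1 x * Pi.single (M := fun _ => ℕ) j 1 y,
      fun x => ?_, fun y => ?_⟩
    · simp [Finset.sum_add_distrib, hD₁, ← Finset.mul_sum]
    · simp [Finset.sum_add_distrib, hD₂, ← Finset.sum_mul]

/-- Enlarging margins along embeddings of the row and column indices can only increase the
number of matrices. -/
lemma marginCount_mono (f : I' ↪ I) (g : J' ↪ J) (a' : I' → ℕ) (b' : J' → ℕ) (a : I → ℕ)
    (b : J → ℕ) (ha : ∀ i, a' i ≤ a (f i)) (hb : ∀ j, b' j ≤ b (g j))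
    (h : ∑ i, a i = ∑ j, b j) : marginCount a' b' ≤ marginCount a b := by
  classical
  rcases isEmpty_or_nonempty
    {D : I' → J' → ℕ // (∀ i, ∑ j, D i j = a' i) ∧ ∀ j, ∑ i, D i j = b' j} with he | ⟨⟨D₀, h₁, h₂⟩⟩
  · simp [marginCount]
  let pa : I → ℕ := fun i => ∑ i', if f i' = i then a' i' else 0
  let pb : J → ℕ := fun j => ∑ j', if g j' = j then b' j' else 0
  have hpa : ∀ i, pa i ≤ a i := by
    intro i
    by_cases hi : ∃ i', f i' = i
    · obtain ⟨i', rfl⟩ := hi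
      simpa [pa] using ha i'
    · push Not at hi
      simp [pa, hi]
  have hpb : ∀ j, pb j ≤ b j := by
    intro j
    by_cases hj : ∃ j', g j' = j
    · obtain ⟨j', rfl⟩ := hj
      simpa [pb] using hb j'
    · push Not at hj
      simp [pb, hj]
  have hsum : ∑ i, pa i = ∑ j, pb j := by
    simp only [pa, pb]
    rw [Finset.sum_comm, Finset.sum_comm (s := (Finset.univ : Finset J))]
    simp only [Finset.sum_ite_eq, Finset.mem_univ, if_true]
    simp_rw [← h₁, ← h₂]
    exact Finset.sum_comm
  obtain ⟨E, hE₁, hE₂⟩ := exists_matrix_with_margins (a - pa) (b - pb) (by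
    simp only [Pi.sub_apply]
    rw [Finset.sum_tsub_distrib _ fun i _ => hpa i, Finset.sum_tsub_distrib _ fun j _ => hpb j,
      h, hsum])
  let pad : (I' → J' → ℕ) → I → J → ℕ := fun D i j =>
    ∑ i', ∑ j', if f i' = i then (if g j' = j then D i' j' else 0) else 0
  refine Nat.card_le_card_of_injective
    (fun D => ⟨pad D.1 + E, fun i => ?_, fun j => ?_⟩) fun D D' hDD' => ?_
  · have : ∑ j, pad D.1 i j = pa i := by
      simp only [pad, pa]
      rw [Finset.sum_comm]
      refine Finset.sum_congr rfl fun i' _ => ?_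
      rw [Finset.sum_comm]
      split_ifs <;> simp [D.2.1]
    simp only [Pi.add_apply, Finset.sum_add_distrib, this, hE₁, Pi.sub_apply]
    have := hpa i
    omega
  · have : ∑ i, pad D.1 i j = pb j := by
      simp only [pad, pb]
      rw [Finset.sum_comm]
      simp_rw [Finset.sum_comm (s := (Finset.univ : Finset I))]
      rw [Finset.sum_comm]
      refine Finset.sum_congr rfl fun j' _ => ?_
      split_ifs <;> simp [D.2.2]
    simp only [Pi.add_apply, Finset.sum_add_distrib, this, hE₂, Pi.sub_apply]
    have := hpb j
    omega
  · ext i j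
    have := congrFun₂ (congrArg Subtype.val hDD') (f i) (g j)
    simpa [pad] using this

/-- Among the square matrices with entries summing to `s`, some choice of margins is attained at
least as often as on average. -/
lemma exists_popular_margins (G : Type*) [Fintype G] [Nonempty G] (s : ℕ) :
    ∃ p q : G → ℕ, ∑ g, p g = s ∧ ∑ g, q g = s ∧
      (Fintype.card G ^ 2).multichoose s ≤ (s + 1) ^ (2 * Fintype.card G) * marginCount p q := by
  classical
  let e : {P : G × G → ℕ // ∑ x, P x = s} ≃ Sym (G × G) s := (Sym.equivNatSumOfFintype _ _).symm
  let : Fintype {P : G × G → ℕ // ∑ x, P x = s} := Fintype.ofEquiv _ e.symm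
  have hcard : Fintype.card {P : G × G → ℕ // ∑ x, P x = s} =
      (Fintype.card G ^ 2).multichoose s := by
    rw [Fintype.card_congr e, Sym.card_sym_eq_multichoose, Fintype.card_prod, sq]
  let T : Finset ((G → ℕ) × (G → ℕ)) :=
    (Fintype.piFinset fun _ => Finset.range (s + 1)) ×ˢ
      (Fintype.piFinset fun _ => Finset.range (s + 1))
  have hT : T.card = (s + 1) ^ (2 * Fintype.card G) := by
    simp [T, Finset.card_product, two_mul, pow_add]
  let φ : {P : G × G → ℕ // ∑ x, P x = s} → (G → ℕ) × (G → ℕ) :=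
    fun P => (fun g => ∑ h, P.1 (g, h), fun h => ∑ g, P.1 (g, h))
  have hφ₁ : ∀ P, ∑ g, (φ P).1 g = s := fun P => by
    rw [← P.2, Fintype.sum_prod_type]
  have hφ₂ : ∀ P, ∑ g, (φ P).2 g = s := fun P => by
    rw [← P.2, Fintype.sum_prod_type_right]
  have hφ : ∀ P ∈ Finset.univ, φ P ∈ T := by
    intro P _
    simp only [T, Finset.mem_product, Fintype.mem_piFinset, Finset.mem_range, Nat.lt_succ_iff]
    refine ⟨fun g => ?_, fun g => ?_⟩
    · rw [← hφ₁ P]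
      exact Finset.single_le_sum (fun _ _ => Nat.zero_le _) (Finset.mem_univ g)
    · rw [← hφ₂ P]
      exact Finset.single_le_sum (fun _ _ => Nat.zero_le _) (Finset.mem_univ g)
  let fib : (G → ℕ) × (G → ℕ) → Finset {P : G × G → ℕ // ∑ x, P x = s} :=
    fun b => Finset.univ.filter fun P => φ P = b
  have : Nonempty {P : G × G → ℕ // ∑ x, P x = s} :=
    ⟨⟨Pi.single (Classical.arbitrary _) s, by simp⟩⟩
  obtain ⟨P₀, -, hP₀⟩ := Finset.exists_max_image Finset.univ (fun P => (fib (φ P)).card)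
    Finset.univ_nonempty
  have hmul := Finset.card_le_mul_card_image_of_maps_to hφ (fib (φ P₀)).card fun b _ => by
    by_cases hb : ∃ P, φ P = b
    · obtain ⟨P, rfl⟩ := hb
      exact hP₀ P (Finset.mem_univ P)
    · rw [Finset.filter_false_of_mem fun P _ hP => hb ⟨P, hP⟩]
      simp
  refine ⟨(φ P₀).1, (φ P₀).2, hφ₁ P₀, hφ₂ P₀, ?_⟩
  rw [Finset.card_univ, hcard, hT, mul_comm] at hmul
  refine hmul.trans (Nat.mul_le_mul_left _ ?_)
  rw [marginCount, ← Fintype.card_coe, ← Nat.card_eq_fintype_card]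
  refine Nat.card_le_card_of_injective (fun P => ⟨fun g h => P.1.1 (g, h), ?_⟩) ?_
  · have hP : φ P.1 = φ P₀ := (Finset.mem_filter.mp P.2).2
    exact ⟨congrFun (congrArg Prod.fst hP), congrFun (congrArg Prod.snd hP)⟩
  · intro P Q h
    ext ⟨g, g'⟩
    exact congrFun₂ (congrArg Subtype.val h) g g'

/-- Gluing cyclically shifted copies of matrices with arbitrary margins produces matrices whose
margins are constant on the clones of each row and column. -/
lemma prod_marginCount_le {G : Type*} [Fintype G] [AddCommGroup G] (s : I → J → ℕ)
    (p q : I → J → G → ℕ) (hp : ∀ i j, ∑ g, p i j g = s i j) (hq : ∀ i j, ∑ g, q i j g = s i j) :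
    ∏ i, ∏ j, marginCount (p i j) (q i j) ^ (Fintype.card G ^ 2) ≤
      marginCount (fun x : I × (G × G) => ∑ j, s x.1 j) (fun y : J × (G × G) => ∑ i, s i y.1) := by
  have hcard : ∏ i, ∏ j, marginCount (p i j) (q i j) ^ (Fintype.card G ^ 2) =
      Nat.card ((i : I) → (j : J) → (G × G → {D : G → G → ℕ //
        (∀ g, ∑ h, D g h = p i j g) ∧ ∀ h, ∑ g, D g h = q i j h})) := by
    simp only [Nat.card_pi, marginCount, Finset.prod_const, Finset.card_univ, Fintype.card_prod, sq]
  rw [hcard]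
  refine Nat.card_le_card_of_injective (fun M => ⟨fun x y =>
    (M x.1 y.1 (x.2.1, y.2.1)).1 (x.2.2 + y.2.1) (y.2.2 + x.2.1), ?_, ?_⟩) ?_
  · rintro ⟨i, u, a⟩
    rw [Fintype.sum_prod_type]
    refine Finset.sum_congr rfl fun j _ => ?_
    rw [Fintype.sum_prod_type, ← hp i j, ← Equiv.sum_comp (Equiv.addLeft a) (p i j)]
    refine Finset.sum_congr rfl fun v _ => ?_
    rw [Equiv.coe_addLeft, ← (M i j (u, v)).2.1]
    exact Equiv.sum_comp (Equiv.addRight u) fun h => (M i j (u, v)).1 (a + v) h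
  · rintro ⟨j, v, b⟩
    rw [Fintype.sum_prod_type]
    refine Finset.sum_congr rfl fun i _ => ?_
    rw [Fintype.sum_prod_type, ← hq i j, ← Equiv.sum_comp (Equiv.addLeft b) (q i j)]
    refine Finset.sum_congr rfl fun u _ => ?_
    rw [Equiv.coe_addLeft, ← (M i j (u, v)).2.2]
    exact Equiv.sum_comp (Equiv.addRight v) fun g => (M i j (u, v)).1 g (b + u)
  · intro M M' h
    ext i j ⟨u, v⟩ a b
    have := congrFun₂ (congrArg Subtype.val h) (i, (u, a - v)) (j, (v, b - u))
    simpa using this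

/-- A lower bound for the number of matrices with cloned margins in terms of block sums. -/
lemma prod_multichoose_le (k : ℕ) (hk : k ≠ 0) (K : ℕ) (hK : k * k ≤ K) (s : I → J → ℕ)
    (a : I → ℕ) (b : J → ℕ) (ha : ∀ i, ∑ j, s i j ≤ a i) (hb : ∀ j, ∑ i, s i j ≤ b j)
    (hab : ∑ i, a i = ∑ j, b j) :
    ∏ i, ∏ j, (k ^ 2).multichoose (s i j) ^ (k ^ 2) ≤
      (∏ i, ∏ j, ((s i j + 1) ^ (2 * k)) ^ (k ^ 2)) *
        marginCount (fun x : I × Fin K => a x.1) (fun y : J × Fin K => b y.1) := by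
  have : NeZero k := ⟨hk⟩
  choose p q hp hq hpq using fun i j => exists_popular_margins (ZMod k) (s i j)
  simp only [ZMod.card] at hpq
  have hprod := prod_marginCount_le s p q hp hq
  simp only [ZMod.card] at hprod
  obtain ⟨e⟩ : Nonempty (ZMod k × ZMod k ↪ Fin K) :=
    Function.Embedding.nonempty_of_card_le (by simpa using hK)
  have hmono := marginCount_mono ((Function.Embedding.refl I).prodMap e)
    ((Function.Embedding.refl J).prodMap e) (fun x => ∑ j, s x.1 j) (fun y => ∑ i, s i y.1)
    (fun x : I × Fin K => a x.1) (fun y : J × Fin K => b y.1) (fun x => ha x.1) (fun y => hb y.1)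
    (by simp [Fintype.sum_prod_type, ← Finset.mul_sum, hab])
  calc ∏ i, ∏ j, (k ^ 2).multichoose (s i j) ^ (k ^ 2)
      ≤ ∏ i, ∏ j, ((s i j + 1) ^ (2 * k) * marginCount (p i j) (q i j)) ^ (k ^ 2) := by
        gcongr with i _ j _
        exact hpq i j
    _ = (∏ i, ∏ j, ((s i j + 1) ^ (2 * k)) ^ (k ^ 2)) *
          ∏ i, ∏ j, marginCount (p i j) (q i j) ^ (k ^ 2) := by
        simp only [mul_pow, Finset.prod_mul_distrib]
    _ ≤ _ := Nat.mul_le_mul_left _ (hprod.trans hmono)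

/-- The generating function bound on the number of matrices with given margins. -/
lemma marginCount_mul_le (a : I → ℕ) (b : J → ℕ) (x : I → ℝ) (y : J → ℝ)
    (hx : ∀ i, x i ∈ Set.Ioo (0 : ℝ) 1) (hy : ∀ j, y j ∈ Set.Ioo (0 : ℝ) 1) :
    marginCount a b * ((∏ i, x i ^ a i) * ∏ j, y j ^ b j) ≤ ∏ i, ∏ j, (1 - x i * y j)⁻¹ := by
  classical
  set S := (finite_matrices_with_margins a b).toFinset with hS
  have hmem : ∀ D, D ∈ S ↔ (∀ i, ∑ j, D i j = a i) ∧ ∀ j, ∑ i, D i j = b j := by simp [hS]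
  have hcard : marginCount a b = S.card := Nat.subtype_card S hmem
  have hweight : ∀ D ∈ S, ∏ i, ∏ j, (x i * y j) ^ D i j = (∏ i, x i ^ a i) * ∏ j, y j ^ b j := by
    intro D hD
    obtain ⟨h₁, h₂⟩ := (hmem D).1 hD
    simp only [mul_pow, Finset.prod_mul_distrib]
    rw [Finset.prod_comm (f := fun i j => y j ^ D i j)]
    simp [Finset.prod_pow_eq_pow_sum, h₁, h₂]
  have hpos : ∀ i j, 0 < x i * y j := fun i j => mul_pos (hx i).1 (hy j).1
  have hlt : ∀ i j, x i * y j < 1 := fun i j =>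
    mul_lt_one_of_nonneg_of_lt_one_left (hx i).1.le (hx i).2 (hy j).2.le
  calc (marginCount a b : ℝ) * ((∏ i, x i ^ a i) * ∏ j, y j ^ b j)
      = ∑ D ∈ S, ∏ i, ∏ j, (x i * y j) ^ D i j := by
        rw [Finset.sum_congr rfl hweight, Finset.sum_const, nsmul_eq_mul, hcard]
    _ ≤ ∑ D ∈ Fintype.piFinset fun i => Fintype.piFinset fun _ : J => Finset.range (a i + 1),
          ∏ i, ∏ j, (x i * y j) ^ D i j := by
        refine Finset.sum_le_sum_of_subset_of_nonneg (fun D hD => ?_) fun D _ _ =>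
          Finset.prod_nonneg fun i _ => Finset.prod_nonneg fun j _ => (pow_pos (hpos i j) _).le
        simp only [Fintype.mem_piFinset, Finset.mem_range, Nat.lt_succ_iff]
        intro i j
        rw [← ((hmem D).1 hD).1 i]
        exact Finset.single_le_sum (fun _ _ => Nat.zero_le _) (Finset.mem_univ j)
    _ = ∏ i, ∏ j, ∑ t ∈ Finset.range (a i + 1), (x i * y j) ^ t := by
        simp only [Finset.prod_univ_sum]
    _ ≤ _ := by
        have hterm : ∀ i j t, 0 ≤ (x i * y j) ^ t := fun i j t => (pow_pos (hpos i j) t).le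
        refine Finset.prod_le_prod (fun i _ => Finset.prod_nonneg fun j _ =>
          Finset.sum_nonneg fun t _ => hterm i j t) fun i _ => Finset.prod_le_prod
          (fun j _ => Finset.sum_nonneg fun t _ => hterm i j t) fun j _ => ?_
        rw [← tsum_geometric_of_lt_one (hpos i j).le (hlt i j)]
        exact (summable_geometric_of_lt_one (hpos i j).le (hlt i j)).sum_le_tsum _
          fun t _ => hterm i j t

end Counting

section Analysis

/-- The entropy of a geometric random variable with mean `z`. -/
noncomputable def geomEntropy (z : ℝ) : ℝ := (1 + z) * Real.log (1 + z) - z * Real.log z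

lemma continuousAt_geomEntropy {z : ℝ} (hz : 0 < z) : ContinuousAt geomEntropy z := by
  have h : 1 + z ≠ 0 := by positivity
  unfold geomEntropy
  fun_prop (disch := first | exact h | exact hz.ne')

lemma geomEntropy_div_one_sub {p : ℝ} (h₀ : 0 < p) (h₁ : p < 1) :
    geomEntropy (p / (1 - p)) = -Real.log (1 - p) - p / (1 - p) * Real.log p := by
  have h : 0 < 1 - p := by linarith
  have e : 1 + p / (1 - p) = (1 - p)⁻¹ := by field_simp; ring
  rw [geomEntropy, e, Real.log_inv, Real.log_div h₀.ne' h.ne', ← e]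
  ring

lemma log_factorial_le (n : ℕ) :
    Real.log n.factorial ≤ n * Real.log n - n + 1 + Real.log n := by
  rcases Nat.eq_zero_or_pos n with rfl | hn
  · simp
  induction n, hn using Nat.le_induction with
  | base => simp
  | succ n hn ih =>
    have hn' : (0 : ℝ) < n := by exact_mod_cast hn
    have hlog : 1 / ((n : ℝ) + 1) ≤ Real.log (n + 1) - Real.log n := by
      have := Real.one_sub_inv_le_log_of_pos (x := ((n : ℝ) + 1) / n) (by positivity)
      rw [Real.log_div (by positivity) hn'.ne'] at this
      refine le_trans (le_of_eq ?_) this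
      field_simp
      ring
    rw [div_le_iff₀ (by positivity)] at hlog
    rw [Nat.factorial_succ, Nat.cast_mul, Real.log_mul (by positivity) (by positivity)]
    push_cast
    nlinarith

lemma le_log_multichoose (N s : ℕ) (hN : N ≠ 0) :
    N * geomEntropy (s / N) - 2 - 3 * Real.log (N + s) ≤ Real.log (N.multichoose s) := by
  obtain ⟨M, rfl⟩ := Nat.exists_eq_succ_of_ne_zero hN
  have hfac : ((M + 1 + s).factorial : ℝ) =
      (M.succ.multichoose s) * s.factorial * M.factorial * (M + 1 + s : ℕ) := by
    have h := Nat.choose_mul_factorial_mul_factorial (n := M + s) (k := s) (by omega)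
    rw [Nat.add_sub_cancel] at h
    rw [Nat.multichoose_eq, show M.succ + s - 1 = M + s by omega,
      show M + 1 + s = (M + s) + 1 by omega, Nat.factorial_succ, ← h]
    push_cast
    ring
  have hpos : 0 < M.succ.multichoose s := by
    rw [Nat.multichoose_eq]
    exact Nat.choose_pos (by omega)
  have hlog := congrArg Real.log hfac
  rw [Real.log_mul (by positivity) (by positivity), Real.log_mul (by positivity) (by positivity),
    Real.log_mul (by positivity) (by positivity)] at hlog
  have h₁ := Stirling.le_log_factorial_stirling (n := M + 1 + s) (by omega)
  have h₂ := log_factorial_le s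
  have h₃ : Real.log M.factorial ≤ Real.log (M + 1).factorial :=
    Real.log_le_log (by positivity) (by exact_mod_cast Nat.factorial_le (by omega))
  have h₄ := log_factorial_le (M + 1)
  have h₅ : Real.log s ≤ Real.log (M + 1 + s : ℕ) := by
    rcases Nat.eq_zero_or_pos s with rfl | hs
    · simpa using Real.log_nonneg (by simp)
    · exact Real.log_le_log (by positivity) (by exact_mod_cast (by omega))
  have h₆ : Real.log (M + 1 : ℕ) ≤ Real.log (M + 1 + s : ℕ) :=
    Real.log_le_log (by positivity) (by exact_mod_cast (by omega))
  have h₇ : 0 ≤ Real.log (M + 1 + s : ℕ) := Real.log_natCast_nonneg _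
  have h₈ : 0 ≤ Real.log (2 * Real.pi) := Real.log_nonneg (by linarith [Real.pi_gt_three])
  have hent : ((M + 1 : ℕ) : ℝ) * geomEntropy (s / (M + 1 : ℕ)) =
      (M + 1 + s : ℕ) * Real.log (M + 1 + s : ℕ) - s * Real.log s -
        (M + 1 : ℕ) * Real.log (M + 1 : ℕ) := by
    have hM : ((M + 1 : ℕ) : ℝ) ≠ 0 := by positivity
    rw [geomEntropy, show 1 + (s : ℝ) / (M + 1 : ℕ) = (M + 1 + s : ℕ) / (M + 1 : ℕ) by
      push_cast; field_simp, Real.log_div (by positivity) hM]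
    rcases Nat.eq_zero_or_pos s with rfl | hs
    · simp
    · rw [Real.log_div (by positivity) hM]
      field_simp
      push_cast
      ring
  rw [Nat.succ_eq_add_one] at *
  rw [hent, ← Nat.cast_add]
  push_cast at *
  linarith

/-- Lower bound for `k⁻²` times the logarithm of the number of `k × k` matrices with mean entry
about `z` and the most popular margins. -/
noncomputable def blockRate (z : ℝ) (k : ℕ) : ℝ :=
  geomEntropy (⌊(k : ℝ) ^ 2 * z⌋₊ / (k : ℝ) ^ 2) -
    (2 / k + 5 * (Real.log (z + 1) / k) + 10 * (Real.log k / k))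

lemma tendsto_blockRate {z : ℝ} (hz : 0 < z) :
    Tendsto (blockRate z) atTop (nhds (geomEntropy z)) := by
  have hcast : Tendsto (fun k : ℕ => (k : ℝ)) atTop atTop := tendsto_natCast_atTop_atTop
  have hsq : Tendsto (fun k : ℕ => (k : ℝ) ^ 2) atTop atTop :=
    (tendsto_pow_atTop two_ne_zero).comp hcast
  have h₁ : Tendsto (fun k : ℕ => (⌊(k : ℝ) ^ 2 * z⌋₊ : ℝ) / (k : ℝ) ^ 2) atTop (nhds z) := by
    simpa [mul_comm, Function.comp_def] using (tendsto_nat_floor_mul_div_atTop hz.le).comp hsq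
  have h₂ : Tendsto (fun k : ℕ => Real.log k / (k : ℝ)) atTop (nhds 0) :=
    (Real.isLittleO_log_id_atTop.tendsto_div_nhds_zero).comp hcast
  have h := ((continuousAt_geomEntropy hz).tendsto.comp h₁).sub
    (((hcast.const_div_atTop 2).add ((hcast.const_div_atTop (Real.log (z + 1))).const_mul 5)).add
      (h₂.const_mul 10))
  unfold blockRate
  simpa using h

lemma blockRate_le {z : ℝ} (hz : 0 < z) {k : ℕ} (hk : k ≠ 0) :
    (k : ℝ) ^ 2 * blockRate z k ≤ Real.log ((k ^ 2).multichoose ⌊(k : ℝ) ^ 2 * z⌋₊) -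
      2 * k * Real.log (⌊(k : ℝ) ^ 2 * z⌋₊ + 1) := by
  have hk1 : (1 : ℝ) ≤ k := by exact_mod_cast Nat.one_le_iff_ne_zero.mpr hk
  have hmc := le_log_multichoose (k ^ 2) ⌊(k : ℝ) ^ 2 * z⌋₊ (pow_ne_zero 2 hk)
  have hs : (⌊(k : ℝ) ^ 2 * z⌋₊ : ℝ) ≤ (k : ℝ) ^ 2 * z := Nat.floor_le (by positivity)
  unfold blockRate
  generalize ⌊(k : ℝ) ^ 2 * z⌋₊ = s at *
  push_cast at hmc
  set A := Real.log (z + 1) + 2 * Real.log k with hA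
  have hA' : Real.log ((k : ℝ) ^ 2 * (z + 1)) = A := by
    rw [Real.log_mul (by positivity) (by positivity), Real.log_pow, hA]
    push_cast
    ring
  have hA0 : 0 ≤ A := by
    have := Real.log_nonneg hk1
    have := Real.log_nonneg (show 1 ≤ z + 1 by linarith)
    positivity
  have h₁ : Real.log ((k : ℝ) ^ 2 + s) ≤ A := by
    rw [← hA']
    exact Real.log_le_log (by positivity) (by linarith)
  have h₂ : Real.log ((s : ℝ) + 1) ≤ A := by
    rw [← hA']
    exact Real.log_le_log (by positivity) (by nlinarith)
  have e : (k : ℝ) ^ 2 * (geomEntropy (s / (k : ℝ) ^ 2) -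
      (2 / k + 5 * (Real.log (z + 1) / k) + 10 * (Real.log k / k))) =
      (k : ℝ) ^ 2 * geomEntropy (s / (k : ℝ) ^ 2) - k * (2 + 5 * A) := by
    rw [hA]
    field_simp
    ring
  rw [e]
  nlinarith [mul_le_mul_of_nonneg_left h₂ (show (0 : ℝ) ≤ 2 * k by positivity),
    mul_nonneg (sub_nonneg.2 hk1) hA0]

end Analysis

section Stationary

variable {I J : Type*} [Fintype I] [Fintype J]

/-- The logarithm of the function whose minimum is `ρ(R, C)`. -/
noncomputable def logGen (r : I → ℕ) (c : J → ℕ) (x : I → ℝ) (y : J → ℝ) : ℝ :=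
  -∑ i, r i * Real.log (x i) - ∑ j, c j * Real.log (y j) - ∑ i, ∑ j, Real.log (1 - x i * y j)

lemma logGen_swap (r : I → ℕ) (c : J → ℕ) (x : I → ℝ) (y : J → ℝ) :
    logGen c r y x = logGen r c x y := by
  simp only [logGen, mul_comm (y _)]
  rw [Finset.sum_comm]
  ring

lemma mul_mem_Ioo_zero_one {s t : ℝ} (hs : s ∈ Set.Ioo (0 : ℝ) 1) (ht : t ∈ Set.Ioo (0 : ℝ) 1) :
    s * t ∈ Set.Ioo (0 : ℝ) 1 :=
  ⟨mul_pos hs.1 ht.1, mul_lt_one_of_nonneg_of_lt_one_left hs.1.le hs.2 ht.2.le⟩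

lemma log_genFun (r : I → ℕ) (c : J → ℕ) {x : I → ℝ} {y : J → ℝ}
    (hx : ∀ i, x i ∈ Set.Ioo (0 : ℝ) 1) (hy : ∀ j, y j ∈ Set.Ioo (0 : ℝ) 1) :
    Real.log ((∏ i, x i ^ (-(r i : ℤ))) * (∏ j, y j ^ (-(c j : ℤ))) *
      (∏ i, ∏ j, (1 - x i * y j)⁻¹)) = logGen r c x y := by
  have hx' : ∀ i, x i ≠ 0 := fun i => (hx i).1.ne'
  have hy' : ∀ j, y j ≠ 0 := fun j => (hy j).1.ne'
  have hxy : ∀ i j, 1 - x i * y j ≠ 0 := fun i j =>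
    (sub_pos.2 (mul_mem_Ioo_zero_one (hx i) (hy j)).2).ne'
  have h₁ : ∏ i, x i ^ (-(r i : ℤ)) ≠ 0 := Finset.prod_ne_zero_iff.2 fun i _ => zpow_ne_zero _ (hx' i)
  have h₂ : ∏ j, y j ^ (-(c j : ℤ)) ≠ 0 := Finset.prod_ne_zero_iff.2 fun j _ => zpow_ne_zero _ (hy' j)
  have h₃ : ∀ i, ∏ j, (1 - x i * y j)⁻¹ ≠ 0 := fun i =>
    Finset.prod_ne_zero_iff.2 fun j _ => inv_ne_zero (hxy i j)
  rw [Real.log_mul (mul_ne_zero h₁ h₂) (Finset.prod_ne_zero_iff.2 fun i _ => h₃ i),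
    Real.log_mul h₁ h₂, Real.log_prod fun i _ => zpow_ne_zero _ (hx' i),
    Real.log_prod fun j _ => zpow_ne_zero _ (hy' j), Real.log_prod fun i _ => h₃ i,
    Finset.sum_congr rfl fun i _ => Real.log_prod fun j _ => inv_ne_zero (hxy i j)]
  simp [logGen, Real.log_inv]
  ring

/-- At a minimiser the matrix `x i * y j / (1 - x i * y j)` has row sums `r`. -/
lemma sum_eq_of_logGen_min (r : I → ℕ) (c : J → ℕ) {x : I → ℝ} {y : J → ℝ}
    (hx : ∀ i, x i ∈ Set.Ioo (0 : ℝ) 1) (hy : ∀ j, y j ∈ Set.Ioo (0 : ℝ) 1)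
    (hmin : ∀ x' : I → ℝ, (∀ i, x' i ∈ Set.Ioo (0 : ℝ) 1) → logGen r c x y ≤ logGen r c x' y)
    (i : I) : ∑ j, x i * y j / (1 - x i * y j) = r i := by
  classical
  let h : I → ℝ → ℝ := fun i t => -(r i * Real.log t) - ∑ j, Real.log (1 - t * y j)
  have hlog : ∀ x' : I → ℝ, logGen r c x' y = ∑ i, h i (x' i) - ∑ j, c j * Real.log (y j) := by
    intro x'
    simp only [logGen, h, Finset.sum_sub_distrib, Finset.sum_neg_distrib]
    ring
  have hloc : IsLocalMin (h i) (x i) := by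
    filter_upwards [Ioo_mem_nhds (hx i).1 (hx i).2] with t ht
    have := hmin (Function.update x i t) fun i' => by
      by_cases hi : i' = i
      · subst hi; simpa using ht
      · simpa [hi] using hx i'
    have herase : ∑ i' ∈ Finset.univ.erase i, h i' (Function.update x i t i') =
        ∑ i' ∈ Finset.univ.erase i, h i' (x i') :=
      Finset.sum_congr rfl fun i' hi' => by
        rw [Function.update_of_ne (Finset.ne_of_mem_erase hi')]
    rw [hlog, hlog, sub_le_sub_iff_right, ← Finset.add_sum_erase _ _ (Finset.mem_univ i),
      ← Finset.add_sum_erase _ (fun i' => h i' (Function.update x i t i')) (Finset.mem_univ i), herase]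
      at this
    simpa only [Function.update_self, add_le_add_iff_right] using this
  have hne : ∀ j, 1 - x i * y j ≠ 0 := fun j =>
    (sub_pos.2 (mul_mem_Ioo_zero_one (hx i) (hy j)).2).ne'
  have hderiv : HasDerivAt (h i) (-(r i * (x i)⁻¹) - ∑ j, -(1 * y j) / (1 - x i * y j)) (x i) :=
    ((Real.hasDerivAt_log (hx i).1.ne').const_mul _).neg.sub <| HasDerivAt.fun_sum fun j _ =>
      (((hasDerivAt_id (x i)).mul_const (y j)).const_sub 1).log (hne j)
  have hzero := hloc.hasDerivAt_eq_zero hderiv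
  have hxi : x i ≠ 0 := (hx i).1.ne'
  calc ∑ j, x i * y j / (1 - x i * y j)
      = x i * -∑ j, -(1 * y j) / (1 - x i * y j) := by
        rw [← Finset.sum_neg_distrib, Finset.mul_sum]
        exact Finset.sum_congr rfl fun j _ => by ring
    _ = x i * (r i * (x i)⁻¹) := by
        congr 1
        linarith
    _ = r i := by field_simp

lemma sum_geomEntropy_eq (r : I → ℕ) (c : J → ℕ) {x : I → ℝ} {y : J → ℝ}
    (hx : ∀ i, x i ∈ Set.Ioo (0 : ℝ) 1) (hy : ∀ j, y j ∈ Set.Ioo (0 : ℝ) 1)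
    (hr : ∀ i, ∑ j, x i * y j / (1 - x i * y j) = r i)
    (hc : ∀ j, ∑ i, x i * y j / (1 - x i * y j) = c j) :
    ∑ i, ∑ j, geomEntropy (x i * y j / (1 - x i * y j)) = logGen r c x y := by
  have h : ∀ i j, geomEntropy (x i * y j / (1 - x i * y j)) = -Real.log (1 - x i * y j) -
      x i * y j / (1 - x i * y j) * Real.log (x i) -
      x i * y j / (1 - x i * y j) * Real.log (y j) := fun i j => by
    have hp := mul_mem_Ioo_zero_one (hx i) (hy j)
    rw [geomEntropy_div_one_sub hp.1 hp.2, Real.log_mul (hx i).1.ne' (hy j).1.ne']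
    ring
  simp only [h, Finset.sum_sub_distrib, Finset.sum_neg_distrib, logGen]
  rw [Finset.sum_comm (f := fun i j => x i * y j / (1 - x i * y j) * Real.log (y j))]
  simp only [← Finset.sum_mul, hr, hc]
  ring

end Stationary

/-- The counting and analytic bounds combined: the number of matrices with cloned margins is at
least exponential in the sum of the block rates. -/
lemma sum_blockRate_le_log_marginCount {I J : Type*} [Fintype I] [Fintype J] (r : I → ℕ)
    (c : J → ℕ) (z : I → J → ℝ) (hz : ∀ i j, 0 < z i j) (hr : ∀ i, ∑ j, z i j = r i)
    (hc : ∀ j, ∑ i, z i j = c j) {k K : ℕ} (hk : k ≠ 0) (hK : k * k ≤ K) :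
    (k : ℝ) ^ 4 * ∑ i, ∑ j, blockRate (z i j) k ≤
      Real.log (marginCount (fun x : I × Fin K => K * r x.1) fun y : J × Fin K => K * c y.1) := by
  have hK' : (k : ℝ) ^ 2 ≤ K := by
    rw [sq]
    exact_mod_cast hK
  set s : I → J → ℕ := fun i j => ⌊(k : ℝ) ^ 2 * z i j⌋₊ with hs_def
  have hs : ∀ i j, (s i j : ℝ) ≤ (k : ℝ) ^ 2 * z i j := fun i j =>
    Nat.floor_le (mul_nonneg (by positivity) (hz i j).le)
  have hrow : ∀ i, ∑ j, s i j ≤ K * r i := fun i => by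
    rw [← Nat.cast_le (α := ℝ)]
    push_cast
    calc ∑ j, (s i j : ℝ) ≤ ∑ j, (k : ℝ) ^ 2 * z i j := Finset.sum_le_sum fun j _ => hs i j
      _ = (k : ℝ) ^ 2 * r i := by rw [← Finset.mul_sum, hr]
      _ ≤ K * r i := by gcongr
  have hcol : ∀ j, ∑ i, s i j ≤ K * c j := fun j => by
    rw [← Nat.cast_le (α := ℝ)]
    push_cast
    calc ∑ i, (s i j : ℝ) ≤ ∑ i, (k : ℝ) ^ 2 * z i j := Finset.sum_le_sum fun i _ => hs i j
      _ = (k : ℝ) ^ 2 * c j := by rw [← Finset.mul_sum, hc]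
      _ ≤ K * c j := by gcongr
  have htot : ∑ i, r i = ∑ j, c j := by
    rw [← Nat.cast_inj (R := ℝ)]
    push_cast
    simp_rw [← hr, ← hc]
    exact Finset.sum_comm
  have hcount := prod_multichoose_le k hk K hK s (fun i => K * r i) (fun j => K * c j) hrow hcol
    (by rw [← Finset.mul_sum, ← Finset.mul_sum, htot])
  set count := marginCount (fun x : I × Fin K => K * r x.1) fun y : J × Fin K => K * c y.1
  have hmc : ∀ i j, 0 < (k ^ 2).multichoose (s i j) := fun i j => by
    rw [Nat.multichoose_eq]
    have : 0 < k ^ 2 := by positivity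
    exact Nat.choose_pos (by omega)
  have hpos : 0 < count := by
    refine Nat.pos_of_ne_zero fun h => ?_
    rw [h, mul_zero] at hcount
    exact absurd hcount (not_le.2 (Finset.prod_pos fun i _ => Finset.prod_pos fun j _ =>
      pow_pos (hmc i j) _))
  have hlog := Real.log_le_log (by
    exact_mod_cast Finset.prod_pos fun i _ => Finset.prod_pos fun j _ =>
      pow_pos (hmc i j) _) (Nat.cast_le (α := ℝ).2 hcount)
  push_cast at hlog
  have hmc' : ∀ i j, ((k ^ 2).multichoose (s i j) : ℝ) ^ (k ^ 2) ≠ 0 := fun i j =>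
    pow_ne_zero _ (by exact_mod_cast (hmc i j).ne')
  have hs' : ∀ i j, (((s i j : ℝ) + 1) ^ (2 * k)) ^ (k ^ 2) ≠ 0 := fun i j => by positivity
  rw [Real.log_mul (Finset.prod_ne_zero_iff.2 fun i _ => Finset.prod_ne_zero_iff.2 fun j _ =>
      hs' i j) (by positivity),
    Real.log_prod fun i _ => Finset.prod_ne_zero_iff.2 fun j _ => hmc' i j,
    Real.log_prod fun i _ => Finset.prod_ne_zero_iff.2 fun j _ => hs' i j,
    Finset.sum_congr rfl fun i _ => Real.log_prod fun j _ => hmc' i j,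
    Finset.sum_congr rfl fun i _ => Real.log_prod fun j _ => hs' i j,
    ← sub_le_iff_le_add'] at hlog
  simp only [← Finset.sum_sub_distrib, Real.log_pow] at hlog
  refine le_trans ?_ hlog
  rw [Finset.mul_sum]
  refine Finset.sum_le_sum fun i _ => ?_
  rw [Finset.mul_sum]
  refine Finset.sum_le_sum fun j _ => ?_
  have h := mul_le_mul_of_nonneg_left (blockRate_le (hz i j) hk) (sq_nonneg (k : ℝ))
  push_cast
  calc _ = (k : ℝ) ^ 2 * ((k : ℝ) ^ 2 * blockRate (z i j) k) := by ring
    _ ≤ _ := h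
    _ = _ := by ring

lemma log_marginCount_cloned_le {I J : Type*} [Fintype I] [Fintype J] (r : I → ℕ)
    (c : J → ℕ) {x : I → ℝ} {y : J → ℝ}
    (hx : ∀ i, x i ∈ Set.Ioo (0 : ℝ) 1) (hy : ∀ j, y j ∈ Set.Ioo (0 : ℝ) 1) (K : ℕ)
    (hpos : 0 < marginCount (fun x : I × Fin K => K * r x.1) fun y : J × Fin K => K * c y.1) :
    Real.log (marginCount (fun x : I × Fin K => K * r x.1) fun y : J × Fin K => K * c y.1) ≤
      (K : ℝ) ^ 2 * logGen r c x y := by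
  have h := marginCount_mul_le (fun x : I × Fin K => K * r x.1) (fun y : J × Fin K => K * c y.1)
    (fun i => x i.1) (fun j => y j.1) (fun i => hx i.1) (fun j => hy j.1)
  generalize marginCount (fun x : I × Fin K => K * r x.1) (fun y : J × Fin K => K * c y.1) = N at *
  have hN : (0 : ℝ) < N := by exact_mod_cast hpos
  have h₁ : 0 < ∏ i : I × Fin K, x i.1 ^ (K * r i.1) :=
    Finset.prod_pos fun i _ => pow_pos (hx i.1).1 _
  have h₂ : 0 < ∏ j : J × Fin K, y j.1 ^ (K * c j.1) :=
    Finset.prod_pos fun j _ => pow_pos (hy j.1).1 _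
  have h₃ : ∀ (i : I × Fin K) (j : J × Fin K), (1 - x i.1 * y j.1)⁻¹ ≠ 0 := fun i j =>
    inv_ne_zero (sub_pos.2 (mul_mem_Ioo_zero_one (hx i.1) (hy j.1)).2).ne'
  have hlog := Real.log_le_log (by positivity) h
  rw [Real.log_mul hN.ne' (by positivity), Real.log_mul h₁.ne' h₂.ne',
    Real.log_prod fun i _ => (pow_pos (hx i.1).1 _).ne',
    Real.log_prod fun j _ => (pow_pos (hy j.1).1 _).ne',
    Real.log_prod fun i _ => Finset.prod_ne_zero_iff.2 fun j _ => h₃ i j,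
    Finset.sum_congr rfl fun i _ => Real.log_prod fun j _ => h₃ i j] at hlog
  simp only [Real.log_pow, Real.log_inv, Fintype.sum_prod_type, Finset.sum_const,
    Finset.card_univ, Fintype.card_fin, nsmul_eq_mul, Finset.sum_neg_distrib, Nat.cast_mul,
    ← Finset.mul_sum, mul_assoc] at hlog
  rw [logGen]
  linarith

lemma natCard_cloned_eq_marginCount {m n : ℕ} (r : Fin m → ℕ) (c : Fin n → ℕ) (k : ℕ) :
    Nat.card {D : Matrix (Fin (k * m)) (Fin (k * n)) ℕ //
      (∀ i, ∑ j, D i j = k * r ⟨i.val / k, Nat.div_lt_of_lt_mul i.isLt⟩) ∧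
      (∀ j, ∑ i, D i j = k * c ⟨j.val / k, Nat.div_lt_of_lt_mul j.isLt⟩)} =
    marginCount (fun x : Fin m × Fin k => k * r x.1) (fun y : Fin n × Fin k => k * c y.1) := by
  let e (l : ℕ) : Fin l × Fin k ≃ Fin (k * l) := finProdFinEquiv.trans (finCongr (mul_comm l k))
  have he : ∀ (l : ℕ) (p : Fin l × Fin k), (e l p).val / k = p.1.val := by
    rintro l ⟨p, q⟩
    have hk : 0 < k := q.pos
    simp [e, Nat.add_mul_div_left _ _ hk, Nat.div_eq_of_lt q.isLt]
  refine (Nat.card_congr (Equiv.subtypeEquiv ((e m).arrowCongr ((e n).arrowCongr (Equiv.refl ℕ)))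
    fun D => ?_)).symm
  rw [← (e m).forall_congr_right, ← (e n).forall_congr_right]
  simp only [he, ← Equiv.sum_comp (e m), ← Equiv.sum_comp (e n)]
  simp

lemma tendsto_sqrt_sq_div : Tendsto (fun K : ℕ => (Nat.sqrt K : ℝ) ^ 2 / K) atTop (nhds 1) := by
  have hsqrt : Tendsto (fun K : ℕ => (Nat.sqrt K : ℝ)) atTop atTop :=
    tendsto_natCast_atTop_atTop.comp <| tendsto_atTop.2 fun b => by
      filter_upwards [eventually_ge_atTop (b * b)] with K hK
      exact Nat.le_sqrt.2 hK
  have hlow : Tendsto (fun K : ℕ => 1 - 2 / (Nat.sqrt K : ℝ)) atTop (nhds 1) := by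
    simpa using (hsqrt.const_div_atTop 2).const_sub 1
  refine tendsto_of_tendsto_of_tendsto_of_le_of_le' hlow tendsto_const_nhds ?_ ?_
  · filter_upwards [eventually_ge_atTop 1] with K hK
    have hk : (0 : ℝ) < Nat.sqrt K := by exact_mod_cast Nat.sqrt_pos.2 hK
    have hK' : (0 : ℝ) < K := by exact_mod_cast hK
    have h₁ : (K : ℝ) ≤ Nat.sqrt K * Nat.sqrt K + Nat.sqrt K + Nat.sqrt K := by
      exact_mod_cast Nat.sqrt_le_add K
    have h₂ : (Nat.sqrt K : ℝ) * Nat.sqrt K ≤ K := by exact_mod_cast Nat.sqrt_le K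
    rw [le_div_iff₀ hK', sub_mul, sub_le_comm, div_mul_eq_mul_div, le_div_iff₀ hk]
    nlinarith
  · filter_upwards [eventually_ge_atTop 1] with K hK
    rw [div_le_one (by exact_mod_cast hK), sq]
    exact_mod_cast Nat.sqrt_le K

/-- For the cloned margins `(R_k, C_k)`,
`(1/k²) ln #(R_k, C_k) → ln ρ(R, C)` as `k → ∞`, where `#(R_k, C_k)` is the number of
`km × kn` nonnegative integer matrices with row sums `R_k` and column sums `C_k`. -/
theorem cloned_margins_count_limit
    (m n N : ℕ) (hm : 1 < m) (hn : 1 < n)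
    (r : Fin m → ℕ) (c : Fin n → ℕ)
    (hr : ∀ i, 0 < r i) (hc : ∀ j, 0 < c j)
    (hrN : ∑ i, r i = N) (hcN : ∑ j, c j = N)
    (ρ : ℝ)
    (hρ : IsLeast {z : ℝ | ∃ (x : Fin m → ℝ) (y : Fin n → ℝ),
      (∀ i, x i ∈ Set.Ioo (0 : ℝ) 1) ∧ (∀ j, y j ∈ Set.Ioo (0 : ℝ) 1) ∧
      (∏ i, x i ^ (-(r i : ℤ))) * (∏ j, y j ^ (-(c j : ℤ))) *
        (∏ i, ∏ j, (1 - x i * y j)⁻¹) = z} ρ) :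
    Tendsto (fun k : ℕ =>
      (1 / (k : ℝ) ^ 2) * Real.log
        (Nat.card {D : Matrix (Fin (k * m)) (Fin (k * n)) ℕ //
          (∀ i, ∑ j, D i j = k * r ⟨i.val / k, Nat.div_lt_of_lt_mul i.isLt⟩) ∧
          (∀ j, ∑ i, D i j = k * c ⟨j.val / k, Nat.div_lt_of_lt_mul j.isLt⟩)}))
      atTop (nhds (Real.log ρ)) := by
  have hsum : ∑ i, r i = ∑ j, c j := hrN.trans hcN.symm
  obtain ⟨⟨x, y, hx, hy, hxy⟩, hleast⟩ := hρ
  have hρ_log : Real.log ρ = logGen r c x y := by rw [← hxy, log_genFun r c hx hy]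
  have hgen_pos : ∀ (x' : Fin m → ℝ) (y' : Fin n → ℝ), (∀ i, x' i ∈ Set.Ioo (0 : ℝ) 1) →
      (∀ j, y' j ∈ Set.Ioo (0 : ℝ) 1) → 0 < (∏ i, x' i ^ (-(r i : ℤ))) *
        (∏ j, y' j ^ (-(c j : ℤ))) * (∏ i, ∏ j, (1 - x' i * y' j)⁻¹) := fun x' y' hx' hy' =>
    mul_pos (mul_pos (Finset.prod_pos fun i _ => zpow_pos (hx' i).1 _)
      (Finset.prod_pos fun j _ => zpow_pos (hy' j).1 _)) (Finset.prod_pos fun i _ =>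
      Finset.prod_pos fun j _ => inv_pos.2 (sub_pos.2 (mul_mem_Ioo_zero_one (hx' i) (hy' j)).2))
  have hmin : ∀ (x' : Fin m → ℝ) (y' : Fin n → ℝ), (∀ i, x' i ∈ Set.Ioo (0 : ℝ) 1) →
      (∀ j, y' j ∈ Set.Ioo (0 : ℝ) 1) → logGen r c x y ≤ logGen r c x' y' := by
    intro x' y' hx' hy'
    rw [← hρ_log, ← log_genFun r c hx' hy']
    exact Real.log_le_log (hxy ▸ hgen_pos x y hx hy) (hleast ⟨x', y', hx', hy', rfl⟩)
  set z : Fin m → Fin n → ℝ := fun i j => x i * y j / (1 - x i * y j) with hz_def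
  have hz : ∀ i j, 0 < z i j := fun i j =>
    div_pos (mul_mem_Ioo_zero_one (hx i) (hy j)).1
      (sub_pos.2 (mul_mem_Ioo_zero_one (hx i) (hy j)).2)
  have hzr : ∀ i, ∑ j, z i j = r i :=
    sum_eq_of_logGen_min r c hx hy fun x' hx' => hmin x' y hx' hy
  have hzc : ∀ j, ∑ i, z i j = c j := fun j => by
    rw [← sum_eq_of_logGen_min c r hy hx (fun y' hy' => by
      rw [logGen_swap r c x y, logGen_swap r c x y']
      exact hmin x y' hx hy') j]
    simp only [hz_def, mul_comm (y j)]
  simp only [natCard_cloned_eq_marginCount]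
  have hsqrt : Tendsto Nat.sqrt atTop atTop := tendsto_atTop.2 fun b => by
    filter_upwards [eventually_ge_atTop (b * b)] with K hK
    exact Nat.le_sqrt.2 hK
  have hlow : Tendsto (fun K : ℕ => ((Nat.sqrt K : ℝ) ^ 2 / K) ^ 2 *
      ∑ i, ∑ j, blockRate (z i j) (Nat.sqrt K)) atTop (nhds (Real.log ρ)) := by
    have h := (tendsto_sqrt_sq_div.pow 2).mul (tendsto_finsetSum Finset.univ fun i _ =>
      tendsto_finsetSum Finset.univ fun j _ => (tendsto_blockRate (hz i j)).comp hsqrt)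
    rwa [one_pow, one_mul, sum_geomEntropy_eq r c hx hy hzr hzc, ← hρ_log] at h
  refine tendsto_of_tendsto_of_tendsto_of_le_of_le' hlow tendsto_const_nhds ?_ ?_
  · filter_upwards [eventually_ge_atTop 1] with K hK
    have h := sum_blockRate_le_log_marginCount r c z hz hzr hzc (Nat.sqrt_pos.2 hK).ne'
      (Nat.sqrt_le K)
    have hK' : (0 : ℝ) < K := by exact_mod_cast hK
    rw [div_mul_eq_mul_div, one_mul, le_div_iff₀ (by positivity)]
    refine le_trans (le_of_eq ?_) h
    field_simp
  · filter_upwards [eventually_ge_atTop 1] with K hK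
    have hK' : (0 : ℝ) < K := by exact_mod_cast hK
    obtain ⟨D, hD⟩ := exists_matrix_with_margins (fun x : Fin m × Fin K => K * r x.1)
      (fun y : Fin n × Fin K => K * c y.1)
      (by simp [Fintype.sum_prod_type, ← Finset.mul_sum, hsum])
    have hpos : 0 < marginCount (fun x : Fin m × Fin K => K * r x.1)
        fun y : Fin n × Fin K => K * c y.1 :=
      Nat.card_pos_iff.2 ⟨⟨⟨D, hD⟩⟩, inferInstance⟩
    rw [div_mul_eq_mul_div, one_mul, div_le_iff₀ (by positivity), hρ_log, mul_comm]
    exact log_marginCount_cloned_le r c hx hy K hpos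
end
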